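/- (Rahman–Virág) For n ≥ 1 let λ denote the product of Lebesgue measures on [0,1]^{F_n}, let H_n be the Schreier graph of the shift action of F_n on [0,1]^{F_n} with respect to the standard generating set, let T be the Cayley graph of F_n with respect to the standard generating set (a 2n-regular tree rooted at the identity 1), and let Aut_• be the group of graph automorphisms a of T with a(1) = 1, acting on [0,1]^{F_n} on the right by (x·a)(δ) = x(a(δ)). Let s_n := sup{ λ(I) : I ⊆ [0,1]^{F_n} is λ-measurable, H_n-independent, and Aut_•-invariant (x ∈ I and a ∈ Aut_• imply x·a ∈ I) }. Then limsup_{n→∞} s_n · n / log n ≤ 1/2, where log denotes the natural logarithm; i.e., s_n ≤ (1 + o(1)) log(2n)/(2n). -/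

import Mathlib

open MeasureTheory

/-- The shift action of a group `Γ` on `A^Γ`, given by `(γ · x) δ = x (δ * γ)`. -/
def shiftMap {Γ A : Type*} [Group Γ] (γ : Γ) (x : Γ → A) : Γ → A :=
  fun δ => x (δ * γ)

/-- `lam` is the product over `F_n` of copies of Lebesgue measure on `[0,1]`,
characterized by its values on cylinders. -/
def IsLebesgueProductMeasure {n : ℕ} (lam : Measure (FreeGroup (Fin n) → unitInterval)) :
    Prop :=
  ∀ (D : Finset (FreeGroup (Fin n))) (S : FreeGroup (Fin n) → Set unitInterval),
    (∀ δ ∈ D, MeasurableSet (S δ)) →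
    lam {x | ∀ δ ∈ D, x δ ∈ S δ} = ∏ δ ∈ D, volume (S δ)

/-- Adjacency in the Schreier graph `H_n` of the shift `F_n ↷ [0,1]^{F_n}` w.r.t. the
standard generating set. -/
def shiftSchreierAdj (n : ℕ) (x y : FreeGroup (Fin n) → unitInterval) : Prop :=
  x ≠ y ∧ ∃ i : Fin n, y = shiftMap (FreeGroup.of i) x ∨ y = shiftMap (FreeGroup.of i)⁻¹ x

/-- Adjacency in the Cayley graph of `F_n` w.r.t. the standard generating set. -/
def cayleyAdj (n : ℕ) (γ δ : FreeGroup (Fin n)) : Prop :=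
  γ ≠ δ ∧ ∃ i : Fin n, γ = FreeGroup.of i * δ ∨ γ = (FreeGroup.of i)⁻¹ * δ


def pw {W A : Type*} [Fintype W] (m : A → ℝ) (x : W → A) : ℝ := ∏ v, m (x v)

theorem pw_nonneg {W A : Type*} [Fintype W] {m : A → ℝ} (hm : ∀ a, 0 ≤ m a) (x : W → A) :
    0 ≤ pw m x := Finset.prod_nonneg fun _ _ => hm _

theorem marg {D W A : Type*} [Fintype D] [Fintype W] [Fintype A] [DecidableEq D] [DecidableEq W]
    {m : A → ℝ} (hm : ∑ a, m a = 1) (ι : D → W) (hι : Function.Injective ι)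
    (g : (D → A) → ℝ) :
    ∑ x : W → A, pw m x * g (x ∘ ι) = ∑ z : D → A, pw m z * g z := by
  classical
  have key : ∀ z : D → A, ∑ x : W → A with x ∘ ι = z, pw m x = pw m z := by
    intro z
    have h1 : (Finset.univ.filter fun x : W → A => x ∘ ι = z) =
        Fintype.piFinset (fun v => Finset.univ.filter fun a => ∀ d, ι d = v → a = z d) := by
      ext x
      simp only [Finset.mem_filter, Finset.mem_univ, true_and, Fintype.mem_piFinset]
      constructor
      · rintro h v d rfl
        exact congrFun h d
      · intro h
        funext d
        exact h _ d rfl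
    rw [h1]
    unfold pw
    rw [← Finset.prod_univ_sum]
    rw [← Finset.prod_subset (Finset.subset_univ (Finset.univ.image ι))]
    · rw [Finset.prod_image (fun a _ b _ h => hι h)]
      refine Finset.prod_congr rfl fun d _ => ?_
      have : (Finset.univ.filter fun a => ∀ d', ι d' = ι d → a = z d') = {z d} := by
        ext a
        simp only [Finset.mem_filter, Finset.mem_univ, true_and, Finset.mem_singleton]
        constructor
        · intro h; exact h d rfl
        · rintro rfl d' h
          rw [hι h]
      rw [this, Finset.sum_singleton]
    · intro v _ hv
      have : (Finset.univ.filter fun a : A => ∀ d', ι d' = v → a = z d') = Finset.univ := by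
        apply Finset.filter_true_of_mem
        intro a _ d' h
        exact absurd (Finset.mem_image.2 ⟨d', Finset.mem_univ _, h⟩) hv
      rw [this, hm]
  rw [← Finset.sum_fiberwise (s := Finset.univ) (g := fun x : W → A => x ∘ ι)]
  refine Finset.sum_congr rfl fun z _ => ?_
  rw [← key z, Finset.sum_mul]
  refine Finset.sum_congr rfl fun x hx => ?_
  rw [(Finset.mem_filter.1 hx).2]

theorem sum_pw {W A : Type*} [Fintype W] [Fintype A] [DecidableEq W]
    {m : A → ℝ} (hm : ∑ a, m a = 1) : ∑ x : W → A, pw m x = 1 := by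
  unfold pw
  have := Finset.prod_univ_sum (fun _ : W => (Finset.univ : Finset A)) (fun _ a => m a)
  rw [Fintype.piFinset_univ] at this
  rw [← this]
  simp [hm]

theorem resample {W A : Type*} [Fintype W] [Fintype A] [DecidableEq W]
    {m : A → ℝ} (hm : ∑ a, m a = 1) (v : W) (F : (W → A) → ℝ) :
    ∑ x : W → A, (∏ u ∈ Finset.univ.erase v, m (x u)) * F x =
      ∑ x : W → A, pw m x * ∑ a, F (Function.update x v a) := by
  have h1 : ∀ x : W → A, pw m x = m (x v) * ∏ u ∈ Finset.univ.erase v, m (x u) := by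
    intro x
    exact (Finset.mul_prod_erase _ (fun u => m (x u)) (Finset.mem_univ v)).symm
  have h2 : ∀ (x : W → A) (a : A), ∏ u ∈ Finset.univ.erase v, m (Function.update x v a u)
      = ∏ u ∈ Finset.univ.erase v, m (x u) := by
    intro x a
    refine Finset.prod_congr rfl fun u hu => ?_
    rw [Function.update_of_ne (Finset.ne_of_mem_erase hu)]
  -- transport along the equivalence
  rw [← (Equiv.funSplitAt v A).symm.sum_comp, ← (Equiv.funSplitAt v A).symm.sum_comp,
    Fintype.sum_prod_type, Fintype.sum_prod_type, Finset.sum_comm]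
  conv_rhs => rw [Finset.sum_comm]
  refine Finset.sum_congr rfl fun r _ => ?_
  have h3 : ∀ a b : A, Function.update ((Equiv.funSplitAt v A).symm (a, r)) v b =
      (Equiv.funSplitAt v A).symm (b, r) := by
    intro a b
    funext u
    by_cases hu : u = v
    · subst hu; simp
    · simp [hu]
  have h4 : ∀ a b : A, ∏ u ∈ Finset.univ.erase v, m ((Equiv.funSplitAt v A).symm (a, r) u) =
      ∏ u ∈ Finset.univ.erase v, m ((Equiv.funSplitAt v A).symm (b, r) u) := by
    intro a b
    rw [← h3 b a, h2]
  have h5 : ∀ a, m ((Equiv.funSplitAt v A).symm (a, r) v) = m a := by intro a; simp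
  simp_rw [h1, h3, h5]
  rcases isEmpty_or_nonempty A with hA | ⟨⟨a0⟩⟩
  · simp
  simp_rw [fun a => h4 a a0]
  rw [← Finset.mul_sum]
  simp_rw [mul_assoc]
  rw [← Finset.sum_mul, hm, one_mul]

theorem resample' {W A : Type*} [Fintype W] [Fintype A] [DecidableEq W]
    {m : A → ℝ} (hm : ∑ a, m a = 1) (v : W) (F : (W → A) → ℝ) :
    ∑ x : W → A, pw m x * F x =
      ∑ x : W → A, pw m x * ∑ a, m a * F (Function.update x v a) := by
  have := resample hm v (fun x => m (x v) * F x)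
  simp only [Function.update_self] at this
  rw [← this]
  refine Finset.sum_congr rfl fun x _ => ?_
  unfold pw
  rw [← Finset.mul_prod_erase _ _ (Finset.mem_univ v)]
  ring

noncomputable def cP {W A : Type*} [Fintype W] [Fintype A] [DecidableEq W] (m : A → ℝ)
    (s : W → Bool) (g : (W → A) → ℝ) (x : W → A) : ℝ :=
  ∑ y : W → A, pw m y * g (fun v => if s v then x v else y v)

noncomputable def cH {W A B : Type*} [Fintype W] [Fintype A] [DecidableEq W] [Fintype B]
    [DecidableEq B] (m : A → ℝ) (Y : (W → A) → B) (s : W → Bool) : ℝ :=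
  ∑ b, ∑ x : W → A, pw m x * Real.negMulLog (cP m s (fun x => if Y x = b then 1 else 0) x)

theorem cP_step {W A : Type*} [Fintype W] [Fintype A] [DecidableEq W] {m : A → ℝ}
    (hm : ∑ a, m a = 1)
    (s : W → Bool) (g : (W → A) → ℝ) (x : W → A) (v : W) :
    cP m (Function.update s v false) g x =
      ∑ a, m a * cP m (Function.update s v true) g (Function.update x v a) := by
  unfold cP
  rw [resample' hm v]
  simp_rw [Finset.mul_sum]
  rw [Finset.sum_comm]
  refine Finset.sum_congr rfl fun a _ => Finset.sum_congr rfl fun y _ => ?_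
  have : (fun u => if Function.update s v false u then x u else Function.update y v a u) =
      (fun u => if Function.update s v true u then Function.update x v a u else y u) := by
    funext u
    by_cases hu : u = v
    · subst hu; simp
    · simp [Function.update_of_ne hu]
  rw [this]; ring

theorem cP_marg {D W A : Type*} [Fintype D] [Fintype W] [Fintype A] [DecidableEq D] [DecidableEq W]
    {m : A → ℝ} (hm : ∑ a, m a = 1) (ι : D → W) (hι : Function.Injective ι)
    (g : (D → A) → ℝ) (s : W → Bool) (x : W → A) :
    cP m s (fun x => g (x ∘ ι)) x = cP m (s ∘ ι) g (x ∘ ι) := by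
  unfold cP
  rw [← marg hm ι hι]
  rfl

theorem cH_marg {D W A B : Type*} [Fintype D] [Fintype W] [Fintype A] [DecidableEq D]
    [DecidableEq W] [Fintype B] [DecidableEq B]
    {m : A → ℝ} (hm : ∑ a, m a = 1) (ι : D → W) (hι : Function.Injective ι)
    (Y : (D → A) → B) (s : W → Bool) :
    cH m (fun x => Y (x ∘ ι)) s = cH m Y (s ∘ ι) := by
  unfold cH
  refine Finset.sum_congr rfl fun b _ => ?_
  rw [← marg hm ι hι]
  refine Finset.sum_congr rfl fun x _ => ?_
  rw [cP_marg hm ι hι (fun x => if Y x = b then 1 else 0)]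

theorem gibbs {x r : ℝ} (hx : 0 ≤ x) (hr : 0 ≤ r) (h : r = 0 → x = 0) :
    Real.negMulLog x ≤ -(x * Real.log r) + r - x := by
  rcases hx.eq_or_lt with rfl | hx
  · simpa using hr
  have hr' : 0 < r := lt_of_le_of_ne hr (fun h' => hx.ne' (h h'.symm))
  have := Real.log_le_sub_one_of_pos (div_pos hr' hx)
  rw [Real.log_div hr'.ne' hx.ne'] at this
  have h2 := mul_le_mul_of_nonneg_left this hx.le
  have h3 : x * (r / x - 1) = r - x := by field_simp
  rw [h3] at h2
  unfold Real.negMulLog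
  nlinarith

/-- concavity of conditional entropy -/
theorem phi_concave {A J : Type*} [Fintype A] [Fintype J] {m : A → ℝ} (hm0 : ∀ a, 0 ≤ m a)
    (u : A → J → ℝ) (hu : ∀ a j, 0 ≤ u a j) :
    ∑ a, m a * (∑ j, Real.negMulLog (u a j) - Real.negMulLog (∑ j, u a j)) ≤
      ∑ j, Real.negMulLog (∑ a, m a * u a j) -
        Real.negMulLog (∑ j, ∑ a, m a * u a j) := by
  set ub : J → ℝ := fun j => ∑ a, m a * u a j with hub
  set U : ℝ := ∑ j, ub j with hU
  have hub0 : ∀ j, 0 ≤ ub j := fun j => Finset.sum_nonneg fun a _ => mul_nonneg (hm0 a) (hu a j)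
  have hU0 : 0 ≤ U := Finset.sum_nonneg fun j _ => hub0 j
  have key : ∀ a, m a * (∑ j, Real.negMulLog (u a j) - Real.negMulLog (∑ j, u a j)) ≤
      ∑ j, m a * u a j * (Real.log U - Real.log (ub j)) := by
    intro a
    rcases (hm0 a).eq_or_lt with h0 | h0
    · simp [← h0]
    have hpos : ∀ j, ub j = 0 → u a j = 0 := by
      intro j hj
      have := (Finset.sum_eq_zero_iff_of_nonneg
        (fun a _ => mul_nonneg (hm0 a) (hu a j))).1 hj a (Finset.mem_univ _)
      rcases mul_eq_zero.1 this with h | h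
      · exact absurd h h0.ne'
      · exact h
    set Ua := ∑ j, u a j with hUa
    have hUa0 : 0 ≤ Ua := Finset.sum_nonneg fun j _ => hu a j
    rcases hUa0.eq_or_lt with hz | hz
    · have : ∀ j, u a j = 0 := fun j =>
        (Finset.sum_eq_zero_iff_of_nonneg (fun j _ => hu a j)).1 hz.symm j (Finset.mem_univ _)
      simp [this, ← hz]
    have hUpos : 0 < U := by
      rcases hU0.eq_or_lt with h | h
      · exfalso
        have h1 : ∀ j, ub j = 0 := fun j =>
          (Finset.sum_eq_zero_iff_of_nonneg (fun j _ => hub0 j)).1 h.symm j (Finset.mem_univ _)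
        have : Ua = 0 := Finset.sum_eq_zero fun j _ => hpos j (h1 j)
        exact hz.ne' this
      · exact h
    have hj : ∀ j, Real.negMulLog (u a j) ≤
        u a j * (Real.log U - Real.log (ub j)) - u a j * Real.log Ua + Ua / U * ub j - u a j := by
      intro j
      by_cases hj0 : ub j = 0
      · simp [hpos j hj0, hj0]
      have := gibbs (hu a j) (r := Ua / U * ub j) (by have := hub0 j; positivity)
        (fun h => by
          exfalso
          rcases mul_eq_zero.1 h with h | h
          · exact (div_pos hz hUpos).ne' h
          · exact hj0 h)
      rw [Real.log_mul (div_pos hz hUpos).ne' hj0, Real.log_div hz.ne' hUpos.ne'] at this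
      linarith
    have hs := Finset.sum_le_sum fun j (_ : j ∈ Finset.univ) => hj j
    rw [Finset.sum_sub_distrib, Finset.sum_add_distrib, Finset.sum_sub_distrib, ← Finset.mul_sum,
      ← Finset.sum_mul, ← hU, ← hUa, div_mul_cancel₀ _ hUpos.ne'] at hs
    simp_rw [mul_assoc]
    rw [← Finset.mul_sum]
    refine mul_le_mul_of_nonneg_left ?_ h0.le
    unfold Real.negMulLog at hs ⊢
    linarith
  refine (Finset.sum_le_sum fun a _ => key a).trans (le_of_eq ?_)
  rw [Finset.sum_comm]
  simp_rw [← Finset.sum_mul]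
  change ∑ j, ub j * (Real.log U - Real.log (ub j)) = _
  simp_rw [mul_sub, Finset.sum_sub_distrib, ← Finset.sum_mul, ← hU]
  unfold Real.negMulLog
  simp only [neg_mul, Finset.sum_neg_distrib]
  ring

theorem cP_nonneg {W A : Type*} [Fintype W] [Fintype A] [DecidableEq W] {m : A → ℝ}
    (hm0 : ∀ a, 0 ≤ m a) (s : W → Bool) (g : (W → A) → ℝ) (hg : ∀ x, 0 ≤ g x) (x : W → A) :
    0 ≤ cP m s g x :=
  Finset.sum_nonneg fun y _ => mul_nonneg (pw_nonneg hm0 y) (hg _)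

theorem dataProc {W A B C : Type*} [Fintype W] [Fintype A] [DecidableEq W] [Fintype B]
    [DecidableEq B] [Fintype C] [DecidableEq C] {m : A → ℝ} (hm0 : ∀ a, 0 ≤ m a)
    (hm : ∑ a, m a = 1) (Y : (W → A) → B) (Z : (W → A) → C) (s : W → Bool) (v : W) :
    cH m Y (Function.update s v false) - cH m Y (Function.update s v true) ≤
    cH m (fun x => (Y x, Z x)) (Function.update s v false) -
      cH m (fun x => (Y x, Z x)) (Function.update s v true) := by
  set q : (W → Bool) → B → C → (W → A) → ℝ := fun s b c x =>
    cP m s (fun x => if (Y x, Z x) = (b, c) then 1 else 0) x with hq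
  have hsum : ∀ s b x, cP m s (fun x => if Y x = b then 1 else 0) x = ∑ c, q s b c x := by
    intro s b x
    simp only [hq, cP]
    rw [Finset.sum_comm]
    refine Finset.sum_congr rfl fun y _ => ?_
    rw [← Finset.mul_sum]
    congr 1
    simp only [Prod.mk.injEq]
    split_ifs with h <;> simp [h]
  set Ph : (W → Bool) → B → (W → A) → ℝ := fun s b x =>
    ∑ c, Real.negMulLog (q s b c x) - Real.negMulLog (∑ c, q s b c x) with hPh
  have hdiff : ∀ s, cH m (fun x => (Y x, Z x)) s - cH m Y s =
      ∑ b, ∑ x, pw m x * Ph s b x := by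
    intro s
    unfold cH
    rw [Fintype.sum_prod_type, ← Finset.sum_sub_distrib]
    refine Finset.sum_congr rfl fun b _ => ?_
    rw [Finset.sum_comm, ← Finset.sum_sub_distrib]
    refine Finset.sum_congr rfl fun x _ => ?_
    rw [hPh, hsum, mul_sub, Finset.mul_sum]
  have hmain : ∑ b, ∑ x, pw m x * Ph (Function.update s v true) b x ≤
      ∑ b, ∑ x, pw m x * Ph (Function.update s v false) b x := by
    refine Finset.sum_le_sum fun b _ => ?_
    rw [resample' hm v]
    refine Finset.sum_le_sum fun x _ => mul_le_mul_of_nonneg_left ?_ (pw_nonneg hm0 x)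
    have := phi_concave hm0 (fun a c => q (Function.update s v true) b c (Function.update x v a))
      (fun a c => cP_nonneg hm0 _ _ (fun x => by positivity) _)
    refine this.trans (le_of_eq ?_)
    have h : ∀ c, ∑ a, m a * q (Function.update s v true) b c (Function.update x v a) =
        q (Function.update s v false) b c x := by
      intro c
      exact (cP_step hm s _ x v).symm
    simp only [h, hPh]
  have h1 := hdiff (Function.update s v true)
  have h2 := hdiff (Function.update s v false)
  linarith

def bern (p : ℝ) : Bool → ℝ := fun b => if b then p else 1 - p

theorem bern_sum (p : ℝ) : ∑ b, bern p b = 1 := by simp [bern]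

theorem bern_nonneg {p : ℝ} (h0 : 0 ≤ p) (h1 : p ≤ 1) (b : Bool) : 0 ≤ bern p b := by
  cases b <;> simp [bern] <;> linarith

noncomputable def GG {W A B : Type*} [Fintype W] [Fintype A] [DecidableEq W] [Fintype B]
    [DecidableEq B] (m : A → ℝ) (Y : (W → A) → B) (p : ℝ) : ℝ :=
  ∑ s : W → Bool, pw (bern p) s * cH m Y s

noncomputable def hh {W A B : Type*} [Fintype W] [Fintype A] [DecidableEq W] [Fintype B]
    [DecidableEq B] (m : A → ℝ) (Y : (W → A) → B) (p : ℝ) (v : W) : ℝ :=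
  ∑ s : W → Bool, pw (bern p) s *
    (cH m Y (Function.update s v false) - cH m Y (Function.update s v true))

theorem russo {W : Type*} [Fintype W] [DecidableEq W] (F : (W → Bool) → ℝ) (p : ℝ) :
    HasDerivAt (fun p => ∑ s : W → Bool, pw (bern p) s * F s)
      (-∑ v, ∑ s : W → Bool, pw (bern p) s *
        (F (Function.update s v false) - F (Function.update s v true))) p := by
  have hb : ∀ b : Bool, HasDerivAt (fun p => bern p b) (if b then 1 else -1) p := by
    intro b
    cases b
    · simpa [bern] using (hasDerivAt_id p).const_sub 1
    · simpa [bern] using hasDerivAt_id' p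
  have h1 : ∀ s : W → Bool, HasDerivAt (fun p => pw (bern p) s * F s)
      ((∑ v, (∏ u ∈ Finset.univ.erase v, bern p (s u)) • (if s v then (1:ℝ) else -1)) * F s) p := by
    intro s
    exact (HasDerivAt.fun_finsetProd (u := Finset.univ) (f := fun v p => bern p (s v))
      (fun v _ => hb (s v))).mul_const _
  have h2 := HasDerivAt.fun_sum (u := Finset.univ) fun s _ => h1 s
  refine h2.congr_deriv (Eq.symm ?_)
  simp_rw [Finset.sum_mul]
  rw [Finset.sum_comm (s := (Finset.univ : Finset (W → Bool))), ← Finset.sum_neg_distrib]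
  refine Finset.sum_congr rfl fun v _ => ?_
  have h3 := resample (bern_sum p) v (fun s => (if s v then (1:ℝ) else -1) * F s)
  simp only [smul_eq_mul, mul_assoc]
  rw [h3, ← Finset.sum_neg_distrib]
  refine Finset.sum_congr rfl fun s _ => ?_
  simp
  ring

theorem cH_swap {W A B C : Type*} [Fintype W] [Fintype A] [DecidableEq W] [Fintype B]
    [DecidableEq B] [Fintype C] [DecidableEq C] {m : A → ℝ}
    (Y : (W → A) → B) (Z : (W → A) → C) (s : W → Bool) :
    cH m (fun x => (Y x, Z x)) s = cH m (fun x => (Z x, Y x)) s := by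
  unfold cH
  rw [Fintype.sum_prod_type, Fintype.sum_prod_type, Finset.sum_comm]
  simp only [Prod.mk.injEq, and_comm]

theorem dataProc' {W A B C : Type*} [Fintype W] [Fintype A] [DecidableEq W] [Fintype B]
    [DecidableEq B] [Fintype C] [DecidableEq C] {m : A → ℝ} (hm0 : ∀ a, 0 ≤ m a)
    (hm : ∑ a, m a = 1) (Y : (W → A) → B) (Z : (W → A) → C) (s : W → Bool) (v : W) :
    cH m Z (Function.update s v false) - cH m Z (Function.update s v true) ≤
    cH m (fun x => (Y x, Z x)) (Function.update s v false) -
      cH m (fun x => (Y x, Z x)) (Function.update s v true) := by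
  rw [cH_swap, cH_swap Y]
  exact dataProc hm0 hm Z Y s v

theorem cH_unit {W A : Type*} [Fintype W] [Fintype A] [DecidableEq W] {m : A → ℝ}
    (hm : ∑ a, m a = 1) (s : W → Bool) : cH m (fun _ => ()) s = 0 := by
  unfold cH cP
  simp [sum_pw hm]

theorem cH_mono {W A B : Type*} [Fintype W] [Fintype A] [DecidableEq W] [Fintype B]
    [DecidableEq B] {m : A → ℝ} (hm0 : ∀ a, 0 ≤ m a)
    (hm : ∑ a, m a = 1) (Y : (W → A) → B) (s : W → Bool) (v : W) :
    0 ≤ cH m Y (Function.update s v false) - cH m Y (Function.update s v true) := by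
  have h := dataProc hm0 hm (fun _ => ()) Y s v
  rw [cH_unit hm, cH_unit hm] at h
  have h2 : ∀ s, cH m (fun x => ((), Y x)) s = cH m Y s := by
    intro s
    unfold cH
    rw [Fintype.sum_prod_type]
    simp
  rw [h2, h2] at h
  linarith

theorem hh_marg {D W A B : Type*} [Fintype D] [Fintype W] [Fintype A] [DecidableEq D]
    [DecidableEq W] [Fintype B] [DecidableEq B]
    {m : A → ℝ} (hm : ∑ a, m a = 1) (ι : D → W) (hι : Function.Injective ι)
    (Y : (D → A) → B) (p : ℝ) (d : D) :
    hh m (fun x => Y (x ∘ ι)) p (ι d) = hh m Y p d := by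
  unfold hh
  rw [← marg (bern_sum p) ι hι]
  refine Finset.sum_congr rfl fun s _ => ?_
  rw [cH_marg hm ι hι, cH_marg hm ι hι, Function.update_comp_eq_of_injective _ hι,
    Function.update_comp_eq_of_injective _ hι]

theorem edge_ineq {D W A B : Type*} [Fintype D] [Fintype W] [Fintype A] [DecidableEq D]
    [DecidableEq W] [Fintype B] [DecidableEq B]
    {m : A → ℝ} (hm0 : ∀ a, 0 ≤ m a) (hm : ∑ a, m a = 1) (ι₀ ι₁ : D → W)
    (hι₀ : Function.Injective ι₀) (hι₁ : Function.Injective ι₁)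
    (P₀ P₁ : Finset D) (hdis : ∀ d ∈ P₀, ∀ d' ∈ P₁, ι₀ d ≠ ι₁ d')
    (Y : (D → A) → B) (p : ℝ) (hp0 : 0 ≤ p) (hp1 : p ≤ 1) :
    ∑ d ∈ P₀, hh m Y p d + ∑ d ∈ P₁, hh m Y p d ≤
      ∑ v, hh m (fun x => (Y (x ∘ ι₀), Y (x ∘ ι₁))) p v := by
  have hpw : ∀ s : W → Bool, 0 ≤ pw (bern p) s := fun s => pw_nonneg (bern_nonneg hp0 hp1) s
  have hn : ∀ v, 0 ≤ hh m (fun x => (Y (x ∘ ι₀), Y (x ∘ ι₁))) p v := fun v =>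
    Finset.sum_nonneg fun s _ => mul_nonneg (hpw s) (cH_mono hm0 hm _ s v)
  have hd : Disjoint (P₀.image ι₀) (P₁.image ι₁) := by
    rw [Finset.disjoint_left]
    intro v h0 h1
    obtain ⟨d, hd, rfl⟩ := Finset.mem_image.1 h0
    obtain ⟨d', hd', h⟩ := Finset.mem_image.1 h1
    exact hdis d hd d' hd' h.symm
  refine le_trans ?_ (Finset.sum_le_sum_of_subset_of_nonneg
    (Finset.subset_univ (P₀.image ι₀ ∪ P₁.image ι₁)) fun v _ _ => hn v)
  rw [Finset.sum_union hd, Finset.sum_image (fun a _ b _ h => hι₀ h),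
    Finset.sum_image (fun a _ b _ h => hι₁ h)]
  refine add_le_add (Finset.sum_le_sum fun d _ => ?_) (Finset.sum_le_sum fun d _ => ?_)
  · rw [← hh_marg hm ι₀ hι₀]
    refine Finset.sum_le_sum fun s _ => mul_le_mul_of_nonneg_left ?_ (hpw s)
    exact dataProc hm0 hm (fun x : W → A => Y (x ∘ ι₀)) (fun x => Y (x ∘ ι₁)) s _
  · rw [← hh_marg hm ι₁ hι₁]
    refine Finset.sum_le_sum fun s _ => mul_le_mul_of_nonneg_left ?_ (hpw s)
    exact dataProc' hm0 hm (fun x : W → A => Y (x ∘ ι₀)) (fun x => Y (x ∘ ι₁)) s _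

theorem pw_bern_one {W : Type*} [Fintype W] (s : W → Bool) (h : s ≠ fun _ => true) :
    pw (bern 1) s = 0 := by
  obtain ⟨v, hv⟩ := Function.ne_iff.1 h
  refine Finset.prod_eq_zero (Finset.mem_univ v) ?_
  simp at hv
  simp [bern, hv]

theorem pw_bern_zero {W : Type*} [Fintype W] (s : W → Bool) (h : s ≠ fun _ => false) :
    pw (bern 0) s = 0 := by
  obtain ⟨v, hv⟩ := Function.ne_iff.1 h
  refine Finset.prod_eq_zero (Finset.mem_univ v) ?_
  simp at hv
  simp [bern, hv]

theorem GG_one {W A B : Type*} [Fintype W] [Fintype A] [DecidableEq W] [Fintype B]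
    [DecidableEq B] {m : A → ℝ} (hm : ∑ a, m a = 1) (Y : (W → A) → B) : GG m Y 1 = 0 := by
  unfold GG
  rw [Finset.sum_eq_single (fun _ => true)]
  · have : cH m Y (fun _ => true) = 0 := by
      unfold cH cP
      simp only [if_true, ← Finset.sum_mul, sum_pw hm, one_mul]
      refine Finset.sum_eq_zero fun b _ => Finset.sum_eq_zero fun x _ => ?_
      split_ifs <;> simp
    simp [this]
  · intro s _ hs
    rw [pw_bern_one s hs, zero_mul]
  · simp

theorem GG_zero {W A B : Type*} [Fintype W] [Fintype A] [DecidableEq W] [Fintype B]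
    [DecidableEq B] {m : A → ℝ} (hm : ∑ a, m a = 1) (Y : (W → A) → B) :
    GG m Y 0 = ∑ b, Real.negMulLog (∑ x, pw m x * if Y x = b then 1 else 0) := by
  unfold GG
  rw [Finset.sum_eq_single (fun _ => false)]
  · unfold cH cP
    simp only [Bool.false_eq_true, if_false, ← Finset.sum_mul, sum_pw hm, one_mul]
    simp [pw, bern]
  · intro s _ hs
    rw [pw_bern_zero s hs, zero_mul]
  · simp

theorem entropy_ineq {I D A B : Type} {W : I → Type} [Fintype I] [Fintype D] [Fintype A]
    [DecidableEq D] [∀ i, Fintype (W i)] [∀ i, DecidableEq (W i)] [Fintype B] [DecidableEq B]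
    {m : A → ℝ} (hm0 : ∀ a, 0 ≤ m a) (hm : ∑ a, m a = 1) (ι₀ ι₁ : ∀ i, D → W i)
    (hι₀ : ∀ i, Function.Injective (ι₀ i)) (hι₁ : ∀ i, Function.Injective (ι₁ i))
    (P₀ P₁ : I → Finset D) (hdis : ∀ i, ∀ d ∈ P₀ i, ∀ d' ∈ P₁ i, ι₀ i d ≠ ι₁ i d')
    (c : ℝ)
    (hc : ∀ d, c ≤ ∑ i, ((if d ∈ P₀ i then (1:ℝ) else 0) + (if d ∈ P₁ i then (1:ℝ) else 0)))
    (Y : (D → A) → B) :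
    c * ∑ b, Real.negMulLog (∑ x, pw m x * if Y x = b then 1 else 0) ≤
      ∑ i, ∑ b : B × B, Real.negMulLog
        (∑ x : W i → A, pw m x * if (Y (x ∘ ι₀ i), Y (x ∘ ι₁ i)) = b then 1 else 0) := by
  set K : ℝ → ℝ := fun p =>
    ∑ i, GG m (fun x : W i → A => (Y (x ∘ ι₀ i), Y (x ∘ ι₁ i))) p - c * GG m Y p with hK
  have hder : ∀ p, HasDerivAt K
      (∑ i, (-∑ v, hh m (fun x : W i → A => (Y (x ∘ ι₀ i), Y (x ∘ ι₁ i))) p v) -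
        c * (-∑ d, hh m Y p d)) p := by
    intro p
    exact (HasDerivAt.fun_sum fun i _ => russo _ p).sub ((russo _ p).const_mul c)
  have hanti : AntitoneOn K (Set.Icc 0 1) := by
    refine antitoneOn_of_deriv_nonpos (convex_Icc 0 1)
      (fun p _ => (hder p).continuousAt.continuousWithinAt)
      (fun p _ => (hder p).differentiableAt.differentiableWithinAt) ?_
    intro p hp
    rw [interior_Icc] at hp
    rw [(hder p).deriv]
    have hn : ∀ d, 0 ≤ hh m Y p d := fun d =>
      Finset.sum_nonneg fun s _ => mul_nonneg (pw_nonneg (bern_nonneg hp.1.le hp.2.le) s)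
        (cH_mono hm0 hm _ s d)
    have h1 := Finset.sum_le_sum fun i (_ : i ∈ Finset.univ) => edge_ineq hm0 hm (ι₀ i) (ι₁ i)
      (hι₀ i) (hι₁ i) (P₀ i) (P₁ i) (hdis i) Y p hp.1.le hp.2.le
    have h2 : c * ∑ d, hh m Y p d ≤
        ∑ i, (∑ d ∈ P₀ i, hh m Y p d + ∑ d ∈ P₁ i, hh m Y p d) := by
      rw [Finset.mul_sum]
      refine (Finset.sum_le_sum fun d _ => mul_le_mul_of_nonneg_right (hc d) (hn d)).trans
        (le_of_eq ?_)
      simp_rw [Finset.sum_mul]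
      rw [Finset.sum_comm]
      refine Finset.sum_congr rfl fun i _ => ?_
      simp_rw [add_mul, Finset.sum_add_distrib, ite_mul, one_mul, zero_mul]
      rw [Finset.sum_ite_mem, Finset.sum_ite_mem, Finset.univ_inter, Finset.univ_inter]
    rw [Finset.sum_neg_distrib]
    linarith
  have h := hanti (Set.left_mem_Icc.2 zero_le_one) (Set.right_mem_Icc.2 zero_le_one) zero_le_one
  simp only [hK, GG_one hm, GG_zero hm] at h
  simp only [Finset.sum_const_zero, mul_zero, sub_zero] at h
  linarith

theorem edge_entropy_bound {B : Type*} [Fintype B] [DecidableEq B] (ρ : B × B → ℝ)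
    (hρ : ∀ b, 0 ≤ ρ b)
    (π : B → ℝ) (h1 : ∀ b, ∑ b', ρ (b, b') = π b) (h2 : ∀ b', ∑ b, ρ (b, b') = π b')
    (hπ : ∑ b, π b = 1) (comp : B → B → Prop) [∀ b b', Decidable (comp b b')]
    (hc : ∀ b b', ¬ comp b b' → ρ (b, b') = 0) :
    ∑ b, Real.negMulLog (ρ b) ≤ 2 * ∑ b, Real.negMulLog (π b) -
      (1 - ∑ b, ∑ b', if comp b b' then π b * π b' else 0) := by
  have hπ0 : ∀ b, 0 ≤ π b := fun b => by rw [← h1]; exact Finset.sum_nonneg fun _ _ => hρ _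
  have hz1 : ∀ b b', π b = 0 → ρ (b, b') = 0 := by
    intro b b' h
    rw [← h1] at h
    exact (Finset.sum_eq_zero_iff_of_nonneg fun _ _ => hρ _).1 h b' (Finset.mem_univ _)
  have hz2 : ∀ b b', π b' = 0 → ρ (b, b') = 0 := by
    intro b b' h
    rw [← h2] at h
    exact (Finset.sum_eq_zero_iff_of_nonneg fun _ _ => hρ _).1 h b (Finset.mem_univ _)
  have key : ∀ b b', Real.negMulLog (ρ (b, b')) ≤
      -(ρ (b, b') * Real.log (π b)) - ρ (b, b') * Real.log (π b') +
        (if comp b b' then π b * π b' else 0) - ρ (b, b') := by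
    intro b b'
    by_cases hcc : comp b b'
    · rw [if_pos hcc]
      by_cases hb : π b = 0
      · simp [hz1 b b' hb, hb]
      by_cases hb' : π b' = 0
      · simp [hz2 b b' hb', hb']
      have := gibbs (hρ (b, b')) (mul_nonneg (hπ0 b) (hπ0 b')) (fun h => by
        rcases mul_eq_zero.1 h with h | h
        · exact absurd h hb
        · exact absurd h hb')
      rw [Real.log_mul hb hb'] at this
      linarith
    · simp [hc b b' hcc, hcc]
  rw [Fintype.sum_prod_type]
  refine (Finset.sum_le_sum fun b _ => Finset.sum_le_sum fun b' _ => key b b').trans (le_of_eq ?_)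
  simp_rw [Finset.sum_sub_distrib, Finset.sum_add_distrib, Finset.sum_sub_distrib,
    Finset.sum_neg_distrib]
  have e1 : ∑ b, ∑ b', ρ (b, b') * Real.log (π b) = - ∑ b, Real.negMulLog (π b) := by
    rw [← Finset.sum_neg_distrib]
    refine Finset.sum_congr rfl fun b _ => ?_
    rw [← Finset.sum_mul, h1, Real.negMulLog]
    ring
  have e2 : ∑ b, ∑ b', ρ (b, b') * Real.log (π b') = - ∑ b, Real.negMulLog (π b) := by
    rw [← Finset.sum_neg_distrib, Finset.sum_comm]
    refine Finset.sum_congr rfl fun b _ => ?_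
    rw [← Finset.sum_mul, h2, Real.negMulLog]
    ring
  have e3 : ∑ b, ∑ b', ρ (b, b') = 1 := by simp_rw [h1, hπ]
  rw [e1, e2, e3]
  ring

theorem toWord_mul_of {n : ℕ} (d : FreeGroup (Fin n)) (i : Fin n)
    (h : d.toWord.getLast? ≠ some (i, false)) :
    (d * FreeGroup.of i).toWord.getLast? = some (i, true) := by
  have hred : FreeGroup.IsReduced (d.toWord ++ [(i, true)]) := by
    unfold FreeGroup.IsReduced
    rw [List.isChain_append]
    refine ⟨FreeGroup.isReduced_toWord, by simp, ?_⟩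
    rintro ⟨j, b⟩ hx y hy
    simp at hy
    subst hy
    intro hji
    simp at hji
    subst hji
    cases b
    · exact absurd hx h
    · rfl
  have : d * FreeGroup.of i = FreeGroup.mk (d.toWord ++ [(i, true)]) := by
    rw [← FreeGroup.mul_mk, FreeGroup.mk_toWord]; rfl
  rw [this, FreeGroup.toWord_mk, hred.reduce_eq]
  simp

theorem local_entropy {n : ℕ} (D : Finset (FreeGroup (Fin n))) {A B : Type} [Fintype A]
    [Fintype B] [DecidableEq B] {m : A → ℝ} (hm0 : ∀ a, 0 ≤ m a) (hm : ∑ a, m a = 1)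
    (Y : (D → A) → B) (comp : B → B → Prop) [∀ b b', Decidable (comp b b')]
    (hcomp : ∀ (i : Fin n) (a : FreeGroup (Fin n) → A),
      comp (Y fun d => a d) (Y fun d => a (d * FreeGroup.of i)))
    (π : B → ℝ) (hπ : ∀ b, π b = ∑ x, pw m x * if Y x = b then 1 else 0) :
    n * (1 - ∑ b, ∑ b', if comp b b' then π b * π b' else 0) ≤ ∑ b, Real.negMulLog (π b) := by
  classical
  have hA : Nonempty A := by
    by_contra h
    rw [not_nonempty_iff] at h
    simp at hm
  let a0 : A := hA.some
  let W : Fin n → Type := fun i => ↥(D ∪ D.image (· * FreeGroup.of i))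
  let ι₀ : ∀ i, D → W i := fun i d => ⟨d, Finset.mem_union_left _ d.2⟩
  let ι₁ : ∀ i, D → W i := fun i d => ⟨d * FreeGroup.of i,
    Finset.mem_union_right _ (Finset.mem_image_of_mem _ d.2)⟩
  have hι₀ : ∀ i, Function.Injective (ι₀ i) := by
    intro i d d' h
    have h' : (ι₀ i d).1 = (ι₀ i d').1 := congrArg Subtype.val h
    exact Subtype.ext h'
  have hι₁ : ∀ i, Function.Injective (ι₁ i) := by
    intro i d d' h
    exact Subtype.ext (mul_right_cancel (congrArg Subtype.val h))
  let P₀ : Fin n → Finset D := fun i =>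
    Finset.univ.filter fun d => (d : FreeGroup (Fin n)).toWord.getLast? ≠ some (i, true)
  let P₁ : Fin n → Finset D := fun i =>
    Finset.univ.filter fun d => (d : FreeGroup (Fin n)).toWord.getLast? ≠ some (i, false)
  have hdis : ∀ i, ∀ d ∈ P₀ i, ∀ d' ∈ P₁ i, ι₀ i d ≠ ι₁ i d' := by
    intro i d hd d' hd' h
    have h' : (d : FreeGroup (Fin n)) = d' * FreeGroup.of i := congrArg Subtype.val h
    have h1 := (Finset.mem_filter.1 hd).2
    have h2 := (Finset.mem_filter.1 hd').2
    rw [h'] at h1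
    exact h1 (toWord_mul_of _ i h2)
  have hc : ∀ d : D, (2 * n - 1 : ℝ) ≤
      ∑ i, ((if d ∈ P₀ i then (1:ℝ) else 0) + (if d ∈ P₁ i then (1:ℝ) else 0)) := by
    intro d
    simp only [P₀, P₁, Finset.mem_filter, Finset.mem_univ, true_and, ne_eq]
    rcases hl : (d : FreeGroup (Fin n)).toWord.getLast? with _ | ⟨j, b⟩
    · simp
      linarith
    · have : ∀ i, ((if ¬ (some (j, b) = some (i, true)) then (1:ℝ) else 0) +
          (if ¬ (some (j, b) = some (i, false)) then (1:ℝ) else 0)) =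
          2 - if j = i then 1 else 0 := by
        intro i
        cases b <;> by_cases hji : j = i <;> simp [hji] <;> norm_num
      simp_rw [this, Finset.sum_sub_distrib]
      simp
      linarith
  have main := entropy_ineq hm0 hm ι₀ ι₁ hι₀ hι₁ P₀ P₁ hdis (2 * n - 1) hc Y
  have hedge : ∀ i, ∑ b : B × B, Real.negMulLog
        (∑ x : W i → A, pw m x * if (Y (x ∘ ι₀ i), Y (x ∘ ι₁ i)) = b then 1 else 0) ≤
      2 * ∑ b, Real.negMulLog (π b) -
      (1 - ∑ b, ∑ b', if comp b b' then π b * π b' else 0) := by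
    intro i
    apply edge_entropy_bound
      (fun b : B × B => ∑ x : W i → A, pw m x * if (Y (x ∘ ι₀ i), Y (x ∘ ι₁ i)) = b then 1 else 0)
    · intro b
      exact Finset.sum_nonneg fun x _ => mul_nonneg (pw_nonneg hm0 x) (by positivity)
    · intro b
      rw [hπ, ← marg hm (ι₀ i) (hι₀ i) (fun x => if Y x = b then 1 else 0), Finset.sum_comm]
      refine Finset.sum_congr rfl fun x _ => ?_
      rw [← Finset.mul_sum]
      congr 1
      simp only [Prod.mk.injEq]
      split_ifs with h <;> simp [h]
    · intro b
      rw [hπ, ← marg hm (ι₁ i) (hι₁ i) (fun x => if Y x = b then 1 else 0), Finset.sum_comm]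
      refine Finset.sum_congr rfl fun x _ => ?_
      rw [← Finset.mul_sum]
      congr 1
      simp only [Prod.mk.injEq]
      split_ifs with h <;> simp [h]
    · simp_rw [hπ]
      rw [Finset.sum_comm]
      simp_rw [← Finset.mul_sum]
      simp [sum_pw hm]
    · intro b b' hbb
      refine Finset.sum_eq_zero fun x _ => ?_
      rw [if_neg, mul_zero]
      intro h
      apply hbb
      have hx := hcomp i (fun g => if hg : g ∈ D ∪ D.image (· * FreeGroup.of i) then x ⟨g, hg⟩
        else a0)
      have e0 : (fun d : D => (fun g => if hg : g ∈ D ∪ D.image (· * FreeGroup.of i)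
          then x ⟨g, hg⟩ else a0) (d : FreeGroup (Fin n))) = x ∘ ι₀ i := by
        funext d
        exact dif_pos (ι₀ i d).2
      have e1 : (fun d : D => (fun g => if hg : g ∈ D ∪ D.image (· * FreeGroup.of i)
          then x ⟨g, hg⟩ else a0) (d * FreeGroup.of i : FreeGroup (Fin n))) = x ∘ ι₁ i := by
        funext d
        exact dif_pos (ι₁ i d).2
      rw [e0, e1] at hx
      have h3 := Prod.mk.inj h
      rwa [h3.1, h3.2] at hx
  simp_rw [← hπ] at main
  have h4 := main.trans (Finset.sum_le_sum fun i _ => hedge i)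
  rw [Finset.sum_const, Finset.card_univ, Fintype.card_fin, nsmul_eq_mul] at h4
  linarith

theorem sum_prod_fun {J C : Type*} [Fintype J] [Fintype C] [DecidableEq J] (g : J → C → ℝ) :
    ∑ y : J → C, ∏ j, g j (y j) = ∏ j, ∑ c, g j c := by
  have := Finset.prod_univ_sum (fun _ : J => (Finset.univ : Finset C)) g
  rw [Fintype.piFinset_univ] at this
  exact this.symm

noncomputable def ker {A : Type} [DecidableEq A] (μ : A → ℝ) (p : ℝ) (a b : A) : ℝ :=
  p * (if a = b then 1 else 0) + (1 - p) * μ b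

noncomputable def QQ {D A : Type} [Fintype D] [Fintype A] [DecidableEq D] [DecidableEq A]
    (μ : A → ℝ) (f : (D → A) → Bool) (p : ℝ) (x : D → A) : ℝ :=
  ∑ y : D → A, (∏ d, ker μ p (x d) (y d)) * (if f y = true then 1 else 0)

theorem ker_nonneg {A : Type} [DecidableEq A] {μ : A → ℝ} (hμ : ∀ a, 0 ≤ μ a) {p : ℝ}
    (h0 : 0 ≤ p) (h1 : p ≤ 1) (a b : A) : 0 ≤ ker μ p a b := by
  unfold ker
  have : 0 ≤ 1 - p := by linarith
  have := hμ b
  positivity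

theorem ker_sum {A : Type} [DecidableEq A] [Fintype A] {μ : A → ℝ} (hμ : ∑ a, μ a = 1) (p : ℝ)
    (a : A) : ∑ b, ker μ p a b = 1 := by
  unfold ker
  rw [Finset.sum_add_distrib, ← Finset.mul_sum, ← Finset.mul_sum, hμ]
  simp

theorem kerprod_sum {D A : Type} [Fintype D] [Fintype A] [DecidableEq D] [DecidableEq A]
    {μ : A → ℝ} (hμ : ∑ a, μ a = 1) (p : ℝ) (x : D → A) :
    ∑ y : D → A, (∏ d, ker μ p (x d) (y d)) = 1 := by
  rw [sum_prod_fun]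
  simp [ker_sum hμ]

theorem QQ_bern {D A : Type} [Fintype D] [Fintype A] [DecidableEq D] [DecidableEq A]
    {μ : A → ℝ} (hμ : ∑ a, μ a = 1) (f : (D → A) → Bool) (p : ℝ) (x : D → A) (b : Bool) :
    ∑ y : D → A, (∏ d, ker μ p (x d) (y d)) * (if f y = b then 1 else 0) =
      bern (QQ μ f p x) b := by
  cases b
  · have h := kerprod_sum hμ p x
    simp only [bern, QQ]
    simp only [Bool.false_eq_true, if_false]
    rw [eq_sub_iff_add_eq, ← Finset.sum_add_distrib]
    refine (Finset.sum_congr rfl fun y _ => ?_).trans h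
    cases f y <;> simp
  · simp [bern, QQ]

theorem QQ_nonneg {D A : Type} [Fintype D] [Fintype A] [DecidableEq D] [DecidableEq A]
    {μ : A → ℝ} (hμ0 : ∀ a, 0 ≤ μ a) (f : (D → A) → Bool) {p : ℝ}
    (h0 : 0 ≤ p) (h1 : p ≤ 1) (x : D → A) : 0 ≤ QQ μ f p x :=
  Finset.sum_nonneg fun y _ => mul_nonneg
    (Finset.prod_nonneg fun d _ => ker_nonneg hμ0 h0 h1 _ _) (by positivity)

theorem QQ_le_one {D A : Type} [Fintype D] [Fintype A] [DecidableEq D] [DecidableEq A]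
    {μ : A → ℝ} (hμ0 : ∀ a, 0 ≤ μ a) (hμ : ∑ a, μ a = 1) (f : (D → A) → Bool) {p : ℝ}
    (h0 : 0 ≤ p) (h1 : p ≤ 1) (x : D → A) : QQ μ f p x ≤ 1 := by
  rw [← kerprod_sum hμ p x]
  refine Finset.sum_le_sum fun y _ => mul_le_of_le_one_right
    (Finset.prod_nonneg fun d _ => ker_nonneg hμ0 h0 h1 _ _) ?_
  split_ifs <;> norm_num

theorem copies {n : ℕ} (D : Finset (FreeGroup (Fin n))) {A : Type} [Fintype A] [DecidableEq A]
    {μ : A → ℝ} (hμ0 : ∀ a, 0 ≤ μ a) (hμ : ∑ a, μ a = 1)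
    (f : (D → A) → Bool)
    (hind : ∀ (i : Fin n) (a : FreeGroup (Fin n) → A),
      ¬ (f (fun d => a d) = true ∧ f (fun d => a (d * FreeGroup.of i)) = true))
    (p : ℝ) (h0 : 0 ≤ p) (h1 : p ≤ 1) (k : ℕ) :
    n * (1 - ∑ x : D → A, ∑ x' : D → A, pw μ x * pw μ x' * (1 - QQ μ f p x * QQ μ f p x') ^ k) ≤
      ∑ b : Fin k → Bool, Real.negMulLog (∑ x : D → A, pw μ x * pw (bern (QQ μ f p x)) b) := by
  classical
  let m : A × (Fin k → A) → ℝ := fun a => μ a.1 * ∏ j, ker μ p a.1 (a.2 j)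
  have hm0 : ∀ a, 0 ≤ m a := fun a => mul_nonneg (hμ0 _)
    (Finset.prod_nonneg fun j _ => ker_nonneg hμ0 h0 h1 _ _)
  have hm : ∑ a, m a = 1 := by
    rw [Fintype.sum_prod_type]
    simp only [m]
    rw [← hμ]
    refine Finset.sum_congr rfl fun a _ => ?_
    rw [← Finset.mul_sum, sum_prod_fun (fun (_ : Fin k) c => ker μ p a c)]
    simp [ker_sum hμ]
  let Y : (D → A × (Fin k → A)) → (Fin k → Bool) := fun z j => f fun d => (z d).2 j
  let comp : (Fin k → Bool) → (Fin k → Bool) → Prop := fun b b' =>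
    ∀ j, ¬ (b j = true ∧ b' j = true)
  have hcomp : ∀ (i : Fin n) (a : FreeGroup (Fin n) → A × (Fin k → A)),
      comp (Y fun d => a d) (Y fun d => a (d * FreeGroup.of i)) := by
    intro i a j
    exact hind i fun g => (a g).2 j
  let π : (Fin k → Bool) → ℝ := fun b => ∑ x : D → A, pw μ x * pw (bern (QQ μ f p x)) b
  let e : (D → A) × (Fin k → D → A) ≃ (D → A × (Fin k → A)) :=
    { toFun := fun xy d => (xy.1 d, fun j => xy.2 j d)
      invFun := fun z => (fun d => (z d).1, fun j d => (z d).2 j)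
      left_inv := fun _ => rfl
      right_inv := fun _ => rfl }
  have hπ : ∀ b, π b = ∑ z, pw m z * if Y z = b then 1 else 0 := by
    intro b
    rw [← e.sum_comp, Fintype.sum_prod_type]
    refine Finset.sum_congr rfl fun x _ => ?_
    have : ∀ y : Fin k → D → A, (pw m (e (x, y)) * if Y (e (x, y)) = b then 1 else 0) =
        pw μ x * ∏ j, ((∏ d, ker μ p (x d) (y j d)) * (if f (y j) = b j then 1 else 0)) := by
      intro y
      have e1 : pw m (e (x, y)) = pw μ x * ∏ j, ∏ d, ker μ p (x d) (y j d) := by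
        simp only [pw, m, e, Equiv.coe_fn_mk]
        rw [Finset.prod_mul_distrib, Finset.prod_comm]
      have e2 : (if Y (e (x, y)) = b then (1:ℝ) else 0) =
          ∏ j, (if f (y j) = b j then (1:ℝ) else 0) := by
        rw [Finset.prod_ite_zero]
        simp only [Finset.prod_const_one, Finset.mem_univ, true_imp_iff]
        congr 1
        simp only [funext_iff, Y, e, Equiv.coe_fn_mk]
      rw [e1, e2, Finset.prod_mul_distrib, mul_assoc]
    simp_rw [this]
    rw [← Finset.mul_sum, sum_prod_fun (fun j y => (∏ d, ker μ p (x d) (y d)) *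
      (if f y = b j then 1 else 0))]
    simp_rw [QQ_bern hμ]
    rfl
  have main := local_entropy D hm0 hm Y comp hcomp π hπ
  refine le_trans (le_of_eq ?_) main
  congr 2
  have hbb : ∀ b b', (if comp b b' then π b * π b' else 0) =
      ∑ x : D → A, ∑ x' : D → A, pw μ x * pw μ x' * ∏ j, (bern (QQ μ f p x) (b j) *
        bern (QQ μ f p x') (b' j) * (if ¬ (b j = true ∧ b' j = true) then 1 else 0)) := by
    intro b b'
    have e2 : (if comp b b' then π b * π b' else 0) = π b * π b' *
        ∏ j, (if ¬ (b j = true ∧ b' j = true) then (1:ℝ) else 0) := by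
      rw [Finset.prod_ite_zero]
      simp only [Finset.prod_const_one, Finset.mem_univ, true_imp_iff, comp]
      split_ifs <;> simp
    rw [e2]
    simp only [π]
    rw [Finset.sum_mul_sum, Finset.sum_mul]
    refine Finset.sum_congr rfl fun x _ => ?_
    rw [Finset.sum_mul]
    refine Finset.sum_congr rfl fun x' _ => ?_
    rw [Finset.prod_mul_distrib, Finset.prod_mul_distrib]
    unfold pw
    ring
  simp_rw [hbb]
  have hsw : ∀ F : (Fin k → Bool) → (Fin k → Bool) → (D → A) → (D → A) → ℝ,
      ∑ b, ∑ b', ∑ x, ∑ x', F b b' x x' = ∑ x, ∑ x', ∑ b, ∑ b', F b b' x x' := by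
    intro F
    simp_rw [← Fintype.sum_prod_type']
    exact Fintype.sum_equiv ⟨fun t => (t.2.2.1, t.2.2.2, t.1, t.2.1),
      fun t => (t.2.2.1, t.2.2.2, t.1, t.2.1), fun _ => rfl, fun _ => rfl⟩ _ _ (fun _ => rfl)
  rw [hsw]
  refine Finset.sum_congr rfl fun x _ => Finset.sum_congr rfl fun x' _ => ?_
  simp_rw [← Finset.mul_sum]
  congr 1
  have h5 : ∀ b : Fin k → Bool, ∑ b' : Fin k → Bool, ∏ j, (bern (QQ μ f p x) (b j) *
        bern (QQ μ f p x') (b' j) * (if ¬ (b j = true ∧ b' j = true) then 1 else 0)) =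
        ∏ j, ∑ c : Bool, (bern (QQ μ f p x) (b j) *
        bern (QQ μ f p x') c * (if ¬ (b j = true ∧ c = true) then 1 else 0)) := by
    intro b
    exact sum_prod_fun (fun j c => (bern (QQ μ f p x) (b j) *
        bern (QQ μ f p x') c * (if ¬ (b j = true ∧ c = true) then (1:ℝ) else 0)))
  simp_rw [h5]
  rw [sum_prod_fun (fun (_ : Fin k) (a : Bool) => ∑ c : Bool, (bern (QQ μ f p x) a *
        bern (QQ μ f p x') c * (if ¬ (a = true ∧ c = true) then (1:ℝ) else 0)))]
  rw [Finset.prod_const, Finset.card_univ, Fintype.card_fin]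
  congr 1
  simp [bern]
  ring

theorem negMulLog_subadd {a b : ℝ} (ha : 0 ≤ a) (hb : 0 ≤ b) :
    Real.negMulLog (a + b) ≤ Real.negMulLog a + Real.negMulLog b := by
  rcases ha.eq_or_lt with rfl | ha
  · simp
  rcases hb.eq_or_lt with rfl | hb
  · simp
  have h1 : Real.log a ≤ Real.log (a + b) := Real.log_le_log ha (by linarith)
  have h2 : Real.log b ≤ Real.log (a + b) := Real.log_le_log hb (by linarith)
  unfold Real.negMulLog
  nlinarith

noncomputable def TT {Ω : Type*} [Fintype Ω] (w Q : Ω → ℝ) (η : ℝ) : ℝ :=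
  ∑ x, if Q x < η then w x * Q x else 0

theorem sum_bern_log (k : ℕ) (q : ℝ) (c : Bool → ℝ) :
    ∑ b : Fin k → Bool, pw (bern q) b * ∑ j, c (b j) = k * (q * c true + (1 - q) * c false) := by
  simp_rw [Finset.mul_sum]
  rw [Finset.sum_comm]
  have : ∀ j : Fin k, ∑ b : Fin k → Bool, pw (bern q) b * c (b j) =
      q * c true + (1 - q) * c false := by
    intro j
    have h := marg (bern_sum q) (fun _ : Unit => j) (fun _ _ _ => rfl) (fun z => c (z ()))
    simp only [Function.comp] at h
    rw [h, ← (Equiv.funUnique Unit Bool).symm.sum_comp]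
    simp [pw, bern]
  simp [this]
  ring

theorem entropy_upper {Ω : Type*} [Fintype Ω] {w Q : Ω → ℝ} (hw0 : ∀ x, 0 ≤ w x)
    (hw : ∑ x, w x = 1) (hQ0 : ∀ x, 0 ≤ Q x) (hQ1 : ∀ x, Q x ≤ 1) {α : ℝ}
    (hα : ∑ x, w x * Q x = α) (hα0 : 0 < α) (hα2 : α ≤ 1 / 2) {η : ℝ} (hη : 0 < η) (k : ℕ) :
    ∑ b : Fin k → Bool, Real.negMulLog (∑ x, w x * pw (bern (Q x)) b) ≤
      k * TT w Q η * (-Real.log α) + 2 * k * α + α / η * (-Real.log α + k * Real.log 2) + α := by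
  have hpw0 : ∀ x (b : Fin k → Bool), 0 ≤ pw (bern (Q x)) b := fun x b =>
    pw_nonneg (bern_nonneg (hQ0 x) (hQ1 x)) b
  set wC : Ω → ℝ := fun x => if Q x < η then w x else 0 with hwC
  set wB : Ω → ℝ := fun x => if Q x < η then 0 else w x with hwB
  have hwC0 : ∀ x, 0 ≤ wC x := fun x => by simp only [hwC]; split_ifs <;> simp [hw0]
  have hwB0 : ∀ x, 0 ≤ wB x := fun x => by simp only [hwB]; split_ifs <;> simp [hw0]
  have hsplit : ∀ x, w x = wB x + wC x := fun x => by
    simp only [hwB, hwC]; split_ifs <;> simp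
  set PB := ∑ x, wB x with hPB
  set PC := ∑ x, wC x with hPC
  have hPBC : PB + PC = 1 := by
    rw [hPB, hPC, ← Finset.sum_add_distrib, ← hw]
    exact Finset.sum_congr rfl fun x _ => (hsplit x).symm
  have hPB0 : 0 ≤ PB := Finset.sum_nonneg fun x _ => hwB0 x
  have hPBle : PB ≤ α / η := by
    rw [le_div_iff₀ hη, hPB, Finset.sum_mul, ← hα]
    refine Finset.sum_le_sum fun x _ => ?_
    simp only [hwB]
    split_ifs with h
    · simpa using mul_nonneg (hw0 x) (hQ0 x)
    · exact mul_le_mul_of_nonneg_left (not_lt.1 h) (hw0 x)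
  have hL : 0 ≤ -Real.log α := by
    have := Real.log_nonpos hα0.le (by linarith); linarith
  set πB : (Fin k → Bool) → ℝ := fun b => ∑ x, wB x * pw (bern (Q x)) b with hπB
  set πC : (Fin k → Bool) → ℝ := fun b => ∑ x, wC x * pw (bern (Q x)) b with hπC
  have hπB0 : ∀ b, 0 ≤ πB b := fun b => Finset.sum_nonneg fun x _ => mul_nonneg (hwB0 x) (hpw0 x b)
  have hπC0 : ∀ b, 0 ≤ πC b := fun b => Finset.sum_nonneg fun x _ => mul_nonneg (hwC0 x) (hpw0 x b)
  have hπBs : ∑ b, πB b = PB := by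
    simp only [hπB]
    rw [Finset.sum_comm]
    simp_rw [← Finset.mul_sum, sum_pw (bern_sum _), mul_one]
    rfl
  have hπCs : ∑ b, πC b = PC := by
    simp only [hπC]
    rw [Finset.sum_comm]
    simp_rw [← Finset.mul_sum, sum_pw (bern_sum _), mul_one]
    rfl
  have hπ : ∀ b, ∑ x, w x * pw (bern (Q x)) b = πB b + πC b := by
    intro b
    simp only [hπB, hπC]
    rw [← Finset.sum_add_distrib]
    refine Finset.sum_congr rfl fun x _ => ?_
    rw [hsplit x]; ring
  -- B part
  have hB : ∑ b, Real.negMulLog (πB b) ≤ PB * (-Real.log α + k * Real.log 2) + α - PB := by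
    have h1 : ∀ b, Real.negMulLog (πB b) ≤
        πB b * (-Real.log α + k * Real.log 2) + α / 2 ^ k - πB b := by
      intro b
      have := gibbs (hπB0 b) (r := α / 2 ^ k) (by positivity) (fun h => by
        exfalso
        have : 0 < α / 2 ^ k := by positivity
        exact this.ne' h)
      rw [Real.log_div hα0.ne' (by positivity), Real.log_pow] at this
      linarith
    refine (Finset.sum_le_sum fun b _ => h1 b).trans (le_of_eq ?_)
    rw [Finset.sum_sub_distrib, Finset.sum_add_distrib, ← Finset.sum_mul, hπBs]
    simp
    field_simp
  -- C part
  have hbα : ∀ b, 0 < bern α b := by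
    intro b
    cases b <;> simp [bern] <;> linarith
  have hC : ∑ b, Real.negMulLog (πC b) ≤ k * TT w Q η * (-Real.log α) + 2 * k * α + 1 - PC := by
    have h1 : ∀ b, Real.negMulLog (πC b) ≤
        -(πC b * ∑ j, Real.log (bern α (b j))) + pw (bern α) b - πC b := by
      intro b
      have hpos : 0 < pw (bern α) b := Finset.prod_pos fun j _ => hbα _
      have := gibbs (hπC0 b) hpos.le (fun h => absurd h hpos.ne')
      unfold pw at this ⊢
      rwa [Real.log_prod (fun j _ => (hbα _).ne')] at this
    refine (Finset.sum_le_sum fun b _ => h1 b).trans ?_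
    rw [Finset.sum_sub_distrib, Finset.sum_add_distrib, hπCs, sum_pw (bern_sum _),
      Finset.sum_neg_distrib]
    have h2 : ∑ b, πC b * ∑ j, Real.log (bern α (b j)) =
        ∑ x, wC x * (k * (Q x * Real.log α + (1 - Q x) * Real.log (1 - α))) := by
      simp only [hπC]
      simp_rw [Finset.sum_mul]
      rw [Finset.sum_comm]
      refine Finset.sum_congr rfl fun x _ => ?_
      simp_rw [mul_assoc, ← Finset.mul_sum]
      rw [sum_bern_log k (Q x) (fun b => Real.log (bern α b))]
      simp [bern]
    have hlog : -(2 * α) ≤ Real.log (1 - α) := by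
      have := Real.one_sub_inv_le_log_of_pos (show 0 < 1 - α by linarith)
      refine le_trans ?_ this
      have h3 : 0 < 1 - α := by linarith
      rw [le_sub_iff_add_le, ← le_sub_iff_add_le', inv_le_iff_one_le_mul₀ h3]
      nlinarith
    have h3 : ∑ x, wC x * (k * (Q x * Real.log α - 2 * α)) ≤
        ∑ x, wC x * (k * (Q x * Real.log α + (1 - Q x) * Real.log (1 - α))) := by
      refine Finset.sum_le_sum fun x _ => mul_le_mul_of_nonneg_left ?_ (hwC0 x)
      refine mul_le_mul_of_nonneg_left ?_ (Nat.cast_nonneg k)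
      have := hQ0 x
      have := hQ1 x
      nlinarith
    have h4 : ∑ x, wC x * (k * (Q x * Real.log α - 2 * α)) =
        k * TT w Q η * Real.log α - 2 * k * α * PC := by
      have : TT w Q η = ∑ x, wC x * Q x := by
        unfold TT
        refine Finset.sum_congr rfl fun x _ => ?_
        simp only [hwC]; split_ifs <;> simp
      rw [this, hPC, Finset.mul_sum, Finset.mul_sum, Finset.sum_mul, ← Finset.sum_sub_distrib]
      refine Finset.sum_congr rfl fun x _ => ?_
      ring
    have h5 : 2 * k * α * PC ≤ 2 * k * α := by
      have : PC ≤ 1 := by linarith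
      exact mul_le_of_le_one_right (by positivity) this
    rw [h2]
    linarith
  have hsub : ∑ b : Fin k → Bool, Real.negMulLog (∑ x, w x * pw (bern (Q x)) b) ≤
      ∑ b, Real.negMulLog (πB b) + ∑ b, Real.negMulLog (πC b) := by
    rw [← Finset.sum_add_distrib]
    refine Finset.sum_le_sum fun b _ => ?_
    rw [hπ]
    exact negMulLog_subadd (hπB0 b) (hπC0 b)
  have hlast : PB * (-Real.log α + k * Real.log 2) ≤ α / η * (-Real.log α + k * Real.log 2) := by
    refine mul_le_mul_of_nonneg_right hPBle ?_
    have := Real.log_nonneg (show (1:ℝ) ≤ 2 by norm_num)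
    positivity
  linarith

theorem one_sub_pow_lower {t ε : ℝ} (ht0 : 0 ≤ t) (ht1 : t ≤ 1) (k : ℕ) (h : k * t ≤ ε) :
    (1 - ε) * (k * t) ≤ 1 - (1 - t) ^ k := by
  have h1 : (1 - t) ^ k * (1 + k * t) ≤ 1 := by
    have hb : 1 + (k:ℝ) * t ≤ (1 + t) ^ k := one_add_mul_le_pow (by linarith) k
    have h2 : 0 ≤ (1 - t) ^ k := pow_nonneg (by linarith) k
    calc (1 - t) ^ k * (1 + k * t) ≤ (1 - t) ^ k * (1 + t) ^ k := by gcongr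
      _ = ((1 - t) * (1 + t)) ^ k := by rw [mul_pow]
      _ ≤ 1 := pow_le_one₀ (by nlinarith) (by nlinarith)
  have hs : 0 ≤ (k:ℝ) * t := by positivity
  have h3 : (1 - t) ^ k ≤ 1 / (1 + k * t) := by
    rw [le_div_iff₀ (by positivity)]; exact h1
  have h4 : 1 / (1 + (k:ℝ) * t) ≤ 1 - (k * t) * (1 - k * t) := by
    rw [div_le_iff₀ (by positivity)]
    nlinarith [mul_nonneg hs (mul_nonneg hs hs)]
  nlinarith

theorem lower_gen {Ω : Type*} [Fintype Ω] {w Q : Ω → ℝ} (hw0 : ∀ x, 0 ≤ w x)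
    (hw : ∑ x, w x = 1) (hQ0 : ∀ x, 0 ≤ Q x) (hQ1 : ∀ x, Q x ≤ 1) (k : ℕ) {ε : ℝ} 
    (c : Ω → Ω → Prop) [∀ x y, Decidable (c x y)]
    (hc : ∀ x y, c x y → k * (Q x * Q y) ≤ ε) :
    (1 - ε) * k * (∑ x, ∑ y, if c x y then (w x * Q x) * (w y * Q y) else 0) ≤
      1 - ∑ x, ∑ y, w x * w y * (1 - Q x * Q y) ^ k := by
  have h1 : (1:ℝ) = ∑ x, ∑ y, w x * w y := by
    rw [← Finset.sum_mul_sum, hw, one_mul]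
  nth_rewrite 2 [h1]
  rw [← Finset.sum_sub_distrib, Finset.mul_sum]
  refine Finset.sum_le_sum fun x _ => ?_
  rw [← Finset.sum_sub_distrib, Finset.mul_sum]
  refine Finset.sum_le_sum fun y _ => ?_
  have ht0 : 0 ≤ Q x * Q y := mul_nonneg (hQ0 x) (hQ0 y)
  have ht1 : Q x * Q y ≤ 1 := mul_le_one₀ (hQ1 x) (hQ0 y) (hQ1 y)
  have hww : 0 ≤ w x * w y := mul_nonneg (hw0 x) (hw0 y)
  have e : w x * w y - w x * w y * (1 - Q x * Q y) ^ k =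
      w x * w y * (1 - (1 - Q x * Q y) ^ k) := by ring
  rw [e]
  split_ifs with h
  · have := mul_le_mul_of_nonneg_left (one_sub_pow_lower ht0 ht1 k (hc x y h)) hww
    refine le_trans (le_of_eq ?_) this
    ring
  · rw [mul_zero]
    refine mul_nonneg hww ?_
    have : (1 - Q x * Q y) ^ k ≤ 1 := pow_le_one₀ (by linarith) (by linarith)
    linarith

theorem lower_both {Ω : Type*} [Fintype Ω] {w Q : Ω → ℝ} (hw0 : ∀ x, 0 ≤ w x)
    (hw : ∑ x, w x = 1) (hQ0 : ∀ x, 0 ≤ Q x) (hQ1 : ∀ x, Q x ≤ 1) (k : ℕ) {ε θ : ℝ}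
    (hθ : k * θ ^ 2 ≤ ε) :
    (1 - ε) * k * TT w Q θ ^ 2 ≤
      1 - ∑ x, ∑ y, w x * w y * (1 - Q x * Q y) ^ k := by
  classical
  have := lower_gen hw0 hw hQ0 hQ1 k (ε := ε) (fun x y => Q x < θ ∧ Q y < θ) (by
    rintro x y ⟨hx, hy⟩
    refine le_trans (mul_le_mul_of_nonneg_left ?_ (Nat.cast_nonneg k)) hθ
    rw [sq]
    exact mul_le_mul hx.le hy.le (hQ0 y) ((hQ0 x).trans hx.le))
  refine le_trans (le_of_eq ?_) this
  congr 1
  rw [sq]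
  unfold TT
  rw [Finset.sum_mul_sum]
  refine Finset.sum_congr rfl fun x _ => Finset.sum_congr rfl fun y _ => ?_
  by_cases hx : Q x < θ <;> by_cases hy : Q y < θ <;> simp [hx, hy]

theorem lower_one {Ω : Type*} [Fintype Ω] {w Q : Ω → ℝ} (hw0 : ∀ x, 0 ≤ w x)
    (hw : ∑ x, w x = 1) (hQ0 : ∀ x, 0 ≤ Q x) (hQ1 : ∀ x, Q x ≤ 1) {α : ℝ}
    (hα : ∑ x, w x * Q x = α) (k : ℕ) {ε η : ℝ}
    (hη : k * η ≤ ε) :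
    (1 - ε) * k * (2 * α * TT w Q η - TT w Q η ^ 2) ≤
      1 - ∑ x, ∑ y, w x * w y * (1 - Q x * Q y) ^ k := by
  classical
  have := lower_gen hw0 hw hQ0 hQ1 k (ε := ε) (fun x y => Q x < η ∨ Q y < η) (by
    intro x y h
    refine le_trans (mul_le_mul_of_nonneg_left ?_ (Nat.cast_nonneg k)) hη
    rcases h with h | h
    · exact (mul_le_of_le_one_right (hQ0 x) (hQ1 y)).trans h.le
    · exact (mul_le_of_le_one_left (hQ0 y) (hQ1 x)).trans h.le)
  refine le_trans (le_of_eq ?_) this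
  congr 1
  have e : 2 * α * TT w Q η - TT w Q η ^ 2 = TT w Q η * α + α * TT w Q η
      - TT w Q η * TT w Q η := by ring
  rw [e, ← hα]
  unfold TT
  rw [Finset.sum_mul_sum, Finset.sum_mul_sum, Finset.sum_mul_sum, ← Finset.sum_add_distrib,
    ← Finset.sum_sub_distrib]
  refine Finset.sum_congr rfl fun x _ => ?_
  rw [← Finset.sum_add_distrib, ← Finset.sum_sub_distrib]
  refine Finset.sum_congr rfl fun y _ => ?_
  by_cases hx : Q x < η <;> by_cases hy : Q y < η <;> simp [hx, hy]

theorem pigeon_diff (g : ℕ → ℝ) (M : ℕ) (hM : 0 < M) {α : ℝ} (h : g 0 - g M ≤ α) :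
    ∃ m < M, g m - g (m + 1) ≤ α / M := by
  by_contra hcon
  push Not at hcon
  have h1 : ∑ m ∈ Finset.range M, (α / M) < ∑ m ∈ Finset.range M, (g m - g (m + 1)) :=
    Finset.sum_lt_sum_of_nonempty (by simpa using hM.ne') fun m hm =>
      hcon m (Finset.mem_range.1 hm)
  rw [Finset.sum_range_sub'] at h1
  have hM' : (M:ℝ) ≠ 0 := by positivity
  simp at h1
  have : (M:ℝ) * (α / M) = α := by field_simp
  linarith

theorem TT_mono {Ω : Type*} [Fintype Ω] {w Q : Ω → ℝ} (hw0 : ∀ x, 0 ≤ w x)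
    (hQ0 : ∀ x, 0 ≤ Q x) {s t : ℝ} (h : s ≤ t) : TT w Q s ≤ TT w Q t := by
  refine Finset.sum_le_sum fun x _ => ?_
  have := mul_nonneg (hw0 x) (hQ0 x)
  split_ifs with h1 h2
  · exact le_rfl
  · exact absurd (h1.trans_le h) h2
  · exact this
  · exact le_rfl

theorem TT_nonneg {Ω : Type*} [Fintype Ω] {w Q : Ω → ℝ} (hw0 : ∀ x, 0 ≤ w x)
    (hQ0 : ∀ x, 0 ≤ Q x) (s : ℝ) : 0 ≤ TT w Q s := by
  refine Finset.sum_nonneg fun x _ => ?_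
  have := mul_nonneg (hw0 x) (hQ0 x)
  split_ifs <;> simp [this]

theorem TT_le {Ω : Type*} [Fintype Ω] {w Q : Ω → ℝ} (hw0 : ∀ x, 0 ≤ w x)
    (hQ0 : ∀ x, 0 ≤ Q x) (s : ℝ) : TT w Q s ≤ ∑ x, w x * Q x := by
  refine Finset.sum_le_sum fun x _ => ?_
  have := mul_nonneg (hw0 x) (hQ0 x)
  split_ifs <;> simp [this]

theorem core_ineq {Ω : Type*} [Fintype Ω] {w Q : Ω → ℝ} (hw0 : ∀ x, 0 ≤ w x)
    (hw : ∑ x, w x = 1) (hQ0 : ∀ x, 0 ≤ Q x) (hQ1 : ∀ x, Q x ≤ 1) {α : ℝ}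
    (hα : ∑ x, w x * Q x = α) (hα0 : 0 < α) (hα2 : α ≤ 1 / 2) (n N : ℕ) (hN : 2 ≤ N)
    (hcop : ∀ k : ℕ, n * (1 - ∑ x, ∑ y, w x * w y * (1 - Q x * Q y) ^ k) ≤
      ∑ b : Fin k → Bool, Real.negMulLog (∑ x, w x * pw (bern (Q x)) b))
    {τ θ : ℝ} (hτ0 : 0 < τ) (hθ : θ * (N:ℝ) ^ (2 * N) = 1)
    (h1 : TT w Q (θ / 2) ≤ τ * α) (h2 : τ * α ≤ TT w Q θ) :
    ∃ a : ℝ, 0 ≤ a ∧ a ≤ τ ∧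
      n * α * (1 - 1 / N) * τ ^ 2 ≤ (a + 2 / N) * (-Real.log α) + (4 + 2 * N ^ (4 * N)) ∧
      n * α * (1 - 1 / N) * (a * (2 - a)) ≤
        (a + 2 / N) * (-Real.log α) + (4 + 2 * N ^ (4 * N)) := by
  have hNr : (2:ℝ) ≤ N := by exact_mod_cast hN
  have hN0 : (0:ℝ) < N := by linarith
  set P : ℝ := (N:ℝ) ^ (2 * N) with hP
  have hP0 : 0 < P := by positivity
  have hP1 : 1 ≤ P := one_le_pow₀ (by linarith)
  have hθ0 : 0 < θ := by
    by_contra hc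
    have := mul_nonpos_of_nonpos_of_nonneg (not_lt.1 hc) hP0.le
    linarith
  let t : ℕ → ℝ := fun m => N / (2 * P * N ^ (2 * m))
  obtain ⟨m, hm, hmd⟩ := pigeon_diff (fun m => TT w Q (t m)) N (by omega) (α := α) (by
    have := TT_nonneg hw0 hQ0 (t N)
    have := TT_le hw0 hQ0 (t 0)
    linarith)
  set R : ℝ := (N:ℝ) ^ (2 * m) with hR
  have hR0 : 0 < R := by positivity
  have hR1 : 1 ≤ R := one_le_pow₀ (by linarith)
  let k : ℕ := 2 * N ^ (2 * N) * N ^ (2 * m)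
  have hk : (k:ℝ) = 2 * P * R := by simp [k, hP, hR]
  have hk0 : (0:ℝ) < k := by rw [hk]; positivity
  have hk1 : (1:ℝ) ≤ k := by rw [hk]; nlinarith
  have ht : t m = N / k := by simp only [t, hk, hR]
  have ht' : t (m + 1) = 1 / (N * k) := by
    simp only [t, hk, hR]
    rw [mul_add, pow_add]
    field_simp
  have hRP : R * N ^ 2 ≤ P := by
    rw [hR, hP, ← pow_add]
    exact pow_le_pow_right₀ (by linarith) (by omega)
  have hkle : (k:ℝ) ≤ 2 * N ^ (4 * N) := by
    rw [hk, mul_assoc]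
    have : (N:ℝ) ^ (4 * N) = P * P := by rw [hP, ← pow_add]; congr 1; omega
    rw [this]
    have : R ≤ P := pow_le_pow_right₀ (by linarith) (by omega)
    gcongr
  have hkθ : k * θ ^ 2 ≤ 1 / N := by
    have e : k * θ ^ 2 = 2 * R * θ := by
      rw [hk]
      calc 2 * P * R * θ ^ 2 = 2 * R * θ * (θ * P) := by ring
        _ = _ := by rw [hθ, mul_one]
    rw [e, le_div_iff₀ hN0]
    calc 2 * R * θ * N ≤ N * R * θ * N := by gcongr
      _ = θ * (R * N ^ 2) := by ring
      _ ≤ θ * P := by gcongr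
      _ = 1 := hθ
  have htθ : t (m + 1) ≤ θ / 2 := by
    rw [ht', div_le_iff₀ (by positivity), hk]
    have : θ / 2 * (N * (2 * P * R)) = (θ * P) * (N * R) := by ring
    rw [this, hθ, one_mul]
    nlinarith
  have hL : 0 ≤ -Real.log α := by
    have := Real.log_nonpos hα0.le (by linarith); linarith
  have hT1 : TT w Q (t (m + 1)) ≤ τ * α := (TT_mono hw0 hQ0 htθ).trans h1
  set T := TT w Q (t (m + 1)) with hT
  have hT0 : 0 ≤ T := TT_nonneg hw0 hQ0 _
  have hup := entropy_upper hw0 hw hQ0 hQ1 hα hα0 hα2 (η := t m) (by rw [ht]; positivity) k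
  have hE : ∑ b : Fin k → Bool, Real.negMulLog (∑ x, w x * pw (bern (Q x)) b) ≤
      k * α * ((T / α + 2 / N) * (-Real.log α) + (4 + 2 * N ^ (4 * N))) := by
    refine hup.trans ?_
    have e1 : α / t m = k * α / N := by rw [ht]; field_simp
    rw [e1]
    have e2 : k * TT w Q (t m) * (-Real.log α) ≤ k * (T + α / N) * (-Real.log α) := by
      gcongr
      linarith
    have e3 : k * α / N * (k * Real.log 2) ≤ k * α * k := by
      have l2 : Real.log 2 ≤ 1 := by
        have := Real.log_two_lt_d9; linarith
      have : k * α / N ≤ k * α := div_le_self (by positivity) (by linarith)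
      have h0 : 0 ≤ Real.log 2 := Real.log_nonneg (by norm_num)
      calc k * α / N * (k * Real.log 2) ≤ k * α * (k * 1) := by gcongr
        _ = _ := by ring
    have e4 : α ≤ k * α := by nlinarith
    have e5 : k * α * k ≤ k * α * (2 * N ^ (4 * N)) := by gcongr
    have e6 : k * α * ((T / α + 2 / N) * (-Real.log α) + (4 + 2 * N ^ (4 * N))) =
        k * (T + α / N) * (-Real.log α) + k * α / N * (-Real.log α) + 4 * (k * α) +
          k * α * (2 * N ^ (4 * N)) := by
      field_simp
      ring
    rw [e6]
    have : 0 < k * α := by positivity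
    linarith
  have hcan : ∀ {u v : ℝ}, k * α * u ≤ k * α * v → u ≤ v := fun h =>
    le_of_mul_le_mul_left h (by positivity)
  refine ⟨T / α, by positivity, ?_, hcan ?_, hcan ?_⟩
  · rw [div_le_iff₀ hα0]; exact hT1
  · have l := lower_both hw0 hw hQ0 hQ1 k hkθ
    have hc := (hcop k).trans hE
    refine le_trans ?_ hc
    have h3 : (τ * α) ^ 2 ≤ TT w Q θ ^ 2 := by gcongr
    have h4 : 0 ≤ 1 - 1 / (N:ℝ) := by
      rw [sub_nonneg, div_le_one hN0]; linarith
    calc k * α * (n * α * (1 - 1 / N) * τ ^ 2) = n * ((1 - 1 / N) * k * (τ * α) ^ 2) := by ring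
      _ ≤ n * ((1 - 1 / N) * k * TT w Q θ ^ 2) := by gcongr
      _ ≤ _ := by gcongr
  · have l := lower_one hw0 hw hQ0 hQ1 hα k (ε := 1 / N) (η := t (m + 1)) (by
      rw [ht']; apply le_of_eq; field_simp)
    have hc := (hcop k).trans hE
    refine le_trans ?_ hc
    rw [← hT] at l
    calc k * α * (n * α * (1 - 1 / N) * (T / α * (2 - T / α))) =
          n * ((1 - 1 / N) * k * (2 * α * T - T ^ 2)) := by field_simp
      _ ≤ _ := by gcongr

theorem ker_stat {A : Type} [DecidableEq A] [Fintype A] {μ : A → ℝ} (hμ : ∑ a, μ a = 1) (p : ℝ)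
    (b : A) : ∑ a, μ a * ker μ p a b = μ b := by
  unfold ker
  have : ∀ a, μ a * (p * (if a = b then 1 else 0) + (1 - p) * μ b) =
      p * (μ a * if a = b then 1 else 0) + μ a * ((1 - p) * μ b) := fun a => by ring
  simp_rw [this]
  rw [Finset.sum_add_distrib, ← Finset.mul_sum, ← Finset.sum_mul, hμ]
  simp
  ring

theorem QQ_mean {D A : Type} [Fintype D] [Fintype A] [DecidableEq D] [DecidableEq A]
    {μ : A → ℝ} (hμ : ∑ a, μ a = 1) (f : (D → A) → Bool) (p : ℝ) :
    ∑ x, pw μ x * QQ μ f p x = ∑ y, pw μ y * (if f y = true then 1 else 0) := by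
  unfold QQ
  simp_rw [Finset.mul_sum]
  rw [Finset.sum_comm]
  refine Finset.sum_congr rfl fun y _ => ?_
  simp_rw [← mul_assoc]
  rw [← Finset.sum_mul]
  congr 1
  unfold pw
  simp_rw [← Finset.prod_mul_distrib]
  rw [sum_prod_fun (fun d a => μ a * ker μ p a (y d))]
  simp [ker_stat hμ]

theorem QQ_zero {D A : Type} [Fintype D] [Fintype A] [DecidableEq D] [DecidableEq A]
    (μ : A → ℝ) (f : (D → A) → Bool) (x : D → A) :
    QQ μ f 0 x = ∑ y, pw μ y * (if f y = true then 1 else 0) := by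
  simp [QQ, ker, pw]

theorem QQ_one {D A : Type} [Fintype D] [Fintype A] [DecidableEq D] [DecidableEq A]
    (μ : A → ℝ) (f : (D → A) → Bool) (x : D → A) :
    QQ μ f 1 x = if f x = true then 1 else 0 := by
  unfold QQ ker
  rw [Finset.sum_eq_single x]
  · simp
  · intro y _ hy
    obtain ⟨d, hd⟩ := Function.ne_iff.1 hy
    rw [Finset.prod_eq_zero (Finset.mem_univ d), zero_mul]
    simp [Ne.symm hd]
  · simp

theorem QQ_cont {D A : Type} [Fintype D] [Fintype A] [DecidableEq D] [DecidableEq A]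
    (μ : A → ℝ) (f : (D → A) → Bool) (x : D → A) :
    Continuous fun p => QQ μ f p x := by
  unfold QQ ker
  fun_prop

theorem choose_p {D A : Type} [Fintype D] [Fintype A] [DecidableEq D] [DecidableEq A]
    {μ : A → ℝ} (hμ0 : ∀ a, 0 ≤ μ a) (hμ : ∑ a, μ a = 1) (f : (D → A) → Bool) {α : ℝ}
    (hα : ∑ y, pw μ y * (if f y = true then 1 else 0) = α) {θ τ : ℝ} (hθ0 : 0 < θ) (hθ1 : θ ≤ 1)
    (hαθ : α ≤ θ / 2) (hτ0 : 0 ≤ τ) (hτ1 : τ ≤ 1) :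
    ∃ p, 0 ≤ p ∧ p ≤ 1 ∧ TT (pw μ) (QQ μ f p) (θ / 2) ≤ τ * α ∧
      τ * α ≤ TT (pw μ) (QQ μ f p) θ := by
  let χ : ℝ → ℝ := fun q => max 0 (min 1 (2 - 2 * q / θ))
  have hχ : Continuous χ := by fun_prop
  have hχ0 : ∀ q, 0 ≤ χ q := fun q => le_max_left _ _
  have hχ1 : ∀ q, χ q ≤ 1 := fun q => max_le (by norm_num) (min_le_left _ _)
  have hlow : ∀ q, q ≤ θ / 2 → χ q = 1 := by
    intro q hq
    have : 1 ≤ 2 - 2 * q / θ := by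
      have : 2 * q / θ ≤ 1 := by rw [div_le_one hθ0]; linarith
      linarith
    simp [χ, this]
  have hhigh : ∀ q, θ ≤ q → χ q = 0 := by
    intro q hq
    have : 2 - 2 * q / θ ≤ 0 := by
      have : 2 ≤ 2 * q / θ := by rw [le_div_iff₀ hθ0]; linarith
      linarith
    simp only [χ]
    exact max_eq_left ((min_le_right _ _).trans this)
  let F : ℝ → ℝ := fun p => ∑ x, pw μ x * (QQ μ f p x * χ (QQ μ f p x))
  have hα0 : 0 ≤ α := by
    rw [← hα]
    exact Finset.sum_nonneg fun y _ => mul_nonneg (pw_nonneg hμ0 y) (by positivity)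
  have hF : Continuous F := by
    refine continuous_finsetSum _ fun x _ => ?_
    have := QQ_cont μ f x
    exact continuous_const.mul (this.mul (hχ.comp this))
  have hF0 : F 0 = α := by
    simp only [F, QQ_zero, hα, hlow α hαθ]
    rw [← Finset.sum_mul, sum_pw hμ]; ring
  have hF1 : F 1 = 0 := by
    refine Finset.sum_eq_zero fun x _ => ?_
    rw [QQ_one]
    split_ifs
    · simp [hhigh 1 hθ1]
    · simp
  have hmem : τ * α ∈ Set.Icc (F 1) (F 0) := by
    rw [hF0, hF1]
    exact ⟨by positivity, mul_le_of_le_one_left hα0 hτ1⟩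
  obtain ⟨p, ⟨hp0, hp1⟩, hp⟩ := intermediate_value_Icc' (zero_le_one' ℝ) hF.continuousOn hmem
  refine ⟨p, hp0, hp1, ?_, ?_⟩
  · rw [← hp]
    refine Finset.sum_le_sum fun x _ => ?_
    have h1 := pw_nonneg hμ0 x
    have h2 := QQ_nonneg hμ0 f hp0 hp1 x
    split_ifs with h
    · rw [hlow _ h.le, mul_one]
    · exact mul_nonneg h1 (mul_nonneg h2 (hχ0 _))
  · rw [← hp]
    refine Finset.sum_le_sum fun x _ => ?_
    have h1 := pw_nonneg hμ0 x
    have h2 := QQ_nonneg hμ0 f hp0 hp1 x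
    split_ifs with h
    · exact mul_le_mul_of_nonneg_left (mul_le_of_le_one_right h2 (hχ1 _)) h1
    · rw [hhigh _ (not_lt.1 h)]; simp

theorem crude {n : ℕ} (D : Finset (FreeGroup (Fin n))) {A : Type} [Fintype A] [DecidableEq A]
    {μ : A → ℝ} (hμ0 : ∀ a, 0 ≤ μ a) (hμ : ∑ a, μ a = 1) (f : (D → A) → Bool)
    (hind : ∀ (i : Fin n) (a : FreeGroup (Fin n) → A),
      ¬ (f (fun d => a d) = true ∧ f (fun d => a (d * FreeGroup.of i)) = true)) {α : ℝ}
    (hα : ∑ y, pw μ y * (if f y = true then 1 else 0) = α) : n * α ^ 2 ≤ 2 := by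
  have h := copies D hμ0 hμ f hind 0 le_rfl zero_le_one 1
  simp only [QQ_zero, hα, pow_one] at h
  have h1 : ∑ x : D → A, ∑ x' : D → A, pw μ x * pw μ x' * (1 - α * α) = 1 - α * α := by
    simp_rw [mul_assoc, ← Finset.mul_sum, ← Finset.sum_mul]
    rw [sum_pw hμ]; ring
  rw [h1] at h
  have h2 : ∑ b : Fin 1 → Bool, Real.negMulLog (∑ x : D → A, pw μ x * pw (bern α) b) ≤
      ∑ b : Fin 1 → Bool, 1 := by
    refine Finset.sum_le_sum fun b _ => ?_
    rw [← Finset.sum_mul, sum_pw hμ, one_mul]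
    have hα0 : 0 ≤ α := by
      rw [← hα]
      exact Finset.sum_nonneg fun y _ => mul_nonneg (pw_nonneg hμ0 y) (by positivity)
    have hα1 : α ≤ 1 := by
      rw [← hα]
      refine (Finset.sum_le_sum fun y _ => mul_le_of_le_one_right (pw_nonneg hμ0 y)
        ?_).trans_eq (sum_pw hμ)
      split_ifs <;> norm_num
    have hp := pw_nonneg (bern_nonneg hα0 hα1) b
    have := gibbs hp zero_le_one (fun h => absurd h one_ne_zero)
    simp at this
    linarith
  have h3 := h.trans h2
  simp at h3
  nlinarith

theorem arith_contra {τ a L l x iN C : ℝ} (hτ0 : 0 < τ) (hτ1 : τ ≤ 1 / 4) (ha0 : 0 ≤ a)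
    (haτ : a ≤ τ) (hl : 0 < l) (hLl : L ≤ l) (hiN0 : 0 ≤ iN)
    (hiN : 2 * iN ≤ τ ^ 3 / 16) (hC : C ≤ τ ^ 3 / 16 * l)
    (hx : (1 / 2 + 4 * τ) * l ≤ x)
    (h1 : x * (1 - iN) * τ ^ 2 ≤ (a + 2 * iN) * L + C)
    (h2 : x * (1 - iN) * (a * (2 - a)) ≤ (a + 2 * iN) * L + C) : False := by
  have hτ3 : τ ^ 3 ≤ τ / 16 := by
    have : τ ^ 2 ≤ 1 / 16 := by nlinarith
    nlinarith
  have hiNτ : iN ≤ τ := by linarith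
  have hR : (a + 2 * iN) * L + C ≤ (a + τ ^ 3 / 8) * l := by
    have : (a + 2 * iN) * L ≤ (a + 2 * iN) * l :=
      mul_le_mul_of_nonneg_left hLl (by linarith)
    have : 2 * iN * l ≤ τ ^ 3 / 16 * l := mul_le_mul_of_nonneg_right hiN hl.le
    linarith
  have hx0 : 0 ≤ x := le_trans (by positivity) hx
  have hx1 : (1 / 2 + 4 * τ) * l * (1 - τ) ≤ x * (1 - iN) :=
    mul_le_mul hx (by linarith) (by linarith) hx0
  have hτl : 0 < τ * l := by positivity
  have hx2 : l * (3 / 8) ≤ x * (1 - iN) := by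
    refine le_trans ?_ hx1
    nlinarith
  have ha : τ ^ 2 / 8 ≤ a := by
    have h3 : l * (3 / 8) * τ ^ 2 ≤ (a + τ ^ 3 / 8) * l :=
      (mul_le_mul_of_nonneg_right hx2 (by positivity)).trans (h1.trans hR)
    have h4 : (3 / 8) * τ ^ 2 ≤ a + τ ^ 3 / 8 := by
      refine le_of_mul_le_mul_right ?_ hl
      linarith
    nlinarith [sq_nonneg τ]
  have hapos : 0 < a := lt_of_lt_of_le (by positivity) ha
  have h5 : τ ^ 3 / 8 ≤ τ * a := by nlinarith
  have h6 : (1 / 2 + 4 * τ) * l * (1 - τ) * (a * (2 - τ)) ≤ (a + τ * a) * l := by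
    calc (1 / 2 + 4 * τ) * l * (1 - τ) * (a * (2 - τ)) ≤ x * (1 - iN) * (a * (2 - a)) := by
          refine mul_le_mul hx1 ?_ ?_ ?_
          · exact mul_le_mul_of_nonneg_left (by linarith) hapos.le
          · exact mul_nonneg hapos.le (by linarith)
          · exact mul_nonneg hx0 (by linarith)
      _ ≤ (a + τ ^ 3 / 8) * l := h2.trans hR
      _ ≤ _ := by gcongr
  have h7 : (1 / 2 + 4 * τ) * (1 - τ) * (2 - τ) ≤ 1 + τ := by
    refine le_of_mul_le_mul_right ?_ (mul_pos hapos hl)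
    linarith
  nlinarith [pow_pos hτ0 3, pow_pos hτ0 2]

theorem rule_bound {κ : ℝ} (hκ0 : 0 < κ) (hκ1 : κ ≤ 1) :
    ∀ᶠ n : ℕ in Filter.atTop, ∀ (D : Finset (FreeGroup (Fin n))) (A : Type) [Fintype A]
      [DecidableEq A] (μ : A → ℝ) (_ : ∀ a, 0 ≤ μ a) (_ : ∑ a, μ a = 1) (f : (D → A) → Bool)
      (_ : ∀ (i : Fin n) (a : FreeGroup (Fin n) → A),
        ¬ (f (fun d => a d) = true ∧ f (fun d => a (d * FreeGroup.of i)) = true)),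
      ∑ y, pw μ y * (if f y = true then 1 else 0) ≤ (1 / 2 + κ) * Real.log n / n := by
  set τ := κ / 4 with hτ
  have hτ0 : 0 < τ := by positivity
  have hτ1 : τ ≤ 1 / 4 := by linarith
  obtain ⟨N₀, hN₀⟩ := exists_nat_ge (32 / τ ^ 3)
  set N := N₀ + 2 with hN
  have hNr : (2:ℝ) ≤ N := by rw [hN]; push_cast; linarith [Nat.cast_nonneg (α := ℝ) N₀]
  have hN1 : 32 / τ ^ 3 ≤ N := by rw [hN]; push_cast; linarith
  have hiN : 2 * (1 / (N:ℝ)) ≤ τ ^ 3 / 16 := by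
    rw [div_le_iff₀ (by positivity)] at hN1
    rw [mul_one_div, div_le_iff₀ (by linarith)]
    linarith
  set P : ℝ := (N:ℝ) ^ (2 * N) with hP
  have hP1 : 1 ≤ P := one_le_pow₀ (by linarith)
  have hθP : 1 / P * P = 1 := by field_simp
  have hθ0 : 0 < 1 / P := by positivity
  have hθ1 : 1 / P ≤ 1 := by rw [div_le_one (by linarith)]; exact hP1
  set C : ℝ := 4 + 2 * (N:ℝ) ^ (4 * N) with hC
  have hlog : Filter.Tendsto (fun n : ℕ => Real.log n) Filter.atTop Filter.atTop :=
    Real.tendsto_log_atTop.comp tendsto_natCast_atTop_atTop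
  filter_upwards [hlog.eventually_ge_atTop 2, hlog.eventually_ge_atTop (C / (τ ^ 3 / 16)),
    tendsto_natCast_atTop_atTop.eventually_ge_atTop (2 / (1 / P / 2) ^ 2 : ℝ),
    Filter.eventually_ge_atTop 1] with n hl2 hlC hn hn1
  intro D A _ _ μ hμ0 hμ f hind
  set α := ∑ y, pw μ y * (if f y = true then 1 else 0) with hα
  by_contra hcon
  push Not at hcon
  have hn0 : (0:ℝ) < n := by exact_mod_cast hn1
  rw [div_lt_iff₀ hn0] at hcon
  have hα0 : 0 < α := by
    by_contra h
    have := mul_nonpos_of_nonpos_of_nonneg (not_lt.1 h) hn0.le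
    have : 0 < (1 / 2 + κ) * Real.log n := by positivity
    linarith
  have hcr := crude D hμ0 hμ f hind hα.symm
  have hαθ : α ≤ 1 / P / 2 := by
    rw [div_le_iff₀ (by positivity)] at hn
    have : n * α ^ 2 ≤ n * (1 / P / 2) ^ 2 := hcr.trans hn
    have := le_of_mul_le_mul_left this hn0
    exact le_of_sq_le_sq this (by positivity)
  obtain ⟨p, hp0, hp1, hT1, hT2⟩ := choose_p hμ0 hμ f hα.symm hθ0 hθ1 hαθ hτ0.le
    (show τ ≤ 1 by linarith)
  obtain ⟨a, ha0, haτ, h1, h2⟩ := core_ineq (pw_nonneg hμ0) (sum_pw hμ)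
    (QQ_nonneg hμ0 f hp0 hp1) (QQ_le_one hμ0 hμ f hp0 hp1) (QQ_mean hμ f p) hα0
    (by linarith) n N (by omega) (fun k => copies D hμ0 hμ f hind p hp0 hp1 k) hτ0 hθP hT1 hT2
  have hlC' : C ≤ τ ^ 3 / 16 * Real.log n := by
    rw [div_le_iff₀ (by positivity)] at hlC
    linarith
  refine arith_contra hτ0 hτ1 ha0 haτ (l := Real.log n) (L := -Real.log α) (x := n * α)
    (iN := 1 / N) (C := C) (by linarith) ?_ (by positivity) hiN hlC' ?_ ?_ ?_
  · rw [← Real.log_inv]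
    refine Real.log_le_log (by positivity) ?_
    rw [inv_le_comm₀ hα0 hn0, inv_le_iff_one_le_mul₀ hn0]
    nlinarith
  · have : 4 * τ = κ := by rw [hτ]; ring
    rw [this]
    linarith
  · rw [mul_one_div]; exact h1
  · rw [mul_one_div]; exact h2

theorem lam_eq {n : ℕ} {lam : Measure (FreeGroup (Fin n) → unitInterval)}
    (hlam : IsLebesgueProductMeasure lam) :
    lam = Measure.infinitePi (fun _ => (volume : Measure unitInterval)) := by
  refine Measure.eq_infinitePi _ fun s t ht => ?_
  exact hlam s t fun i _ => ht i

theorem shift_measurable {n : ℕ} (γ : FreeGroup (Fin n)) :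
    Measurable (shiftMap γ : (FreeGroup (Fin n) → unitInterval) → _) := by
  unfold shiftMap
  exact measurable_pi_lambda _ fun δ => measurable_pi_apply _

theorem shift_mp {n : ℕ} {lam : Measure (FreeGroup (Fin n) → unitInterval)}
    (hlam : IsLebesgueProductMeasure lam) (γ : FreeGroup (Fin n)) :
    MeasurePreserving (shiftMap γ) lam lam := by
  classical
  refine ⟨shift_measurable γ, ?_⟩
  conv_rhs => rw [lam_eq hlam]
  refine Measure.eq_infinitePi _ fun s t ht => ?_
  rw [Measure.map_apply (shift_measurable γ)
    (MeasurableSet.pi s.countable_toSet fun i _ => ht i)]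
  have h := hlam (s.image (· * γ)) (fun δ => t (δ * γ⁻¹)) (fun δ _ => ht _)
  rw [Finset.prod_image (fun a _ b _ hab => mul_right_cancel hab)] at h
  simp only [mul_inv_cancel_right] at h
  rw [← h]
  congr 1
  ext x
  simp only [shiftMap, Set.pi, Set.mem_preimage, Set.mem_ofPred_eq, Finset.mem_image,
    forall_exists_index, and_imp, forall_apply_eq_imp_iff₂, mul_inv_cancel_right]
  rfl

theorem fix_null {n : ℕ} {lam : Measure (FreeGroup (Fin n) → unitInterval)}
    (hlam : IsLebesgueProductMeasure lam) (i : Fin n) :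
    lam {x | x = shiftMap (FreeGroup.of i) x} = 0 := by
  classical
  let φ : (FreeGroup (Fin n) → unitInterval) → unitInterval × unitInterval :=
    fun x => (x 1, x (FreeGroup.of i))
  have hφ : Measurable φ := (measurable_pi_apply _).prodMk (measurable_pi_apply _)
  have hne : (1 : FreeGroup (Fin n)) ≠ FreeGroup.of i := (FreeGroup.of_ne_one i).symm
  have hmap : (volume : Measure unitInterval).prod volume = lam.map φ := by
    refine Measure.prod_eq fun s t hs ht => ?_
    rw [Measure.map_apply hφ (hs.prod ht)]
    have h := hlam {1, FreeGroup.of i} (fun δ => if δ = 1 then s else t) (by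
      intro δ _; split_ifs <;> assumption)
    rw [Finset.prod_pair hne] at h
    simp only [if_true, hne.symm, if_false] at h
    rw [← h]
    congr 1
    ext x
    simp [φ, hne.symm]
  have hdiag : MeasurableSet {z : unitInterval × unitInterval | z.1 = z.2} :=
    measurableSet_eq_fun measurable_fst measurable_snd
  have h0 : lam.map φ {z : unitInterval × unitInterval | z.1 = z.2} = 0 := by
    rw [← hmap, Measure.measure_prod_null hdiag]
    refine Filter.Eventually.of_forall fun x => ?_
    have : (Prod.mk x ⁻¹' {z : unitInterval × unitInterval | z.1 = z.2}) = {x} := by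
      ext y; simp [eq_comm]
    simp [this]
  rw [Measure.map_apply hφ hdiag] at h0
  refine measure_mono_null (fun x hx => ?_) h0
  have := congrFun hx 1
  simpa [shiftMap, φ] using this

def Cl (Γ : Type) : Set (Set (Γ → unitInterval)) :=
  {C | ∃ (A : Type) (_ : Fintype A) (q : unitInterval → A) (D : Finset Γ),
    (∀ a, MeasurableSet (q ⁻¹' {a})) ∧
      ∀ x y, (∀ δ ∈ D, q (x δ) = q (y δ)) → x ∈ C → y ∈ C}

theorem Cl_alg (Γ : Type) : IsSetAlgebra (Cl Γ) where
  empty_mem := ⟨Unit, inferInstance, fun _ => (), ∅, fun a => by simp, fun x y _ h => h.elim⟩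
  compl_mem := by
    rintro s ⟨A, _, q, D, hq, h⟩
    exact ⟨A, inferInstance, q, D, hq, fun x y hxy hx hy =>
      hx (h y x (fun δ hδ => (hxy δ hδ).symm) hy)⟩
  union_mem := by
    classical
    rintro s t ⟨A, _, q, D, hq, h⟩ ⟨A', _, q', D', hq', h'⟩
    refine ⟨A × A', inferInstance, fun u => (q u, q' u), D ∪ D', ?_, ?_⟩
    · rintro ⟨a, a'⟩
      have : (fun u => (q u, q' u)) ⁻¹' {(a, a')} = q ⁻¹' {a} ∩ q' ⁻¹' {a'} := by
        ext u; simp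
      rw [this]
      exact (hq a).inter (hq' a')
    · intro x y hxy hx
      rcases hx with hx | hx
      · exact Or.inl (h x y (fun δ hδ => (Prod.ext_iff.1 (hxy δ (Finset.mem_union_left _ hδ))).1) hx)
      · exact Or.inr
          (h' x y (fun δ hδ => (Prod.ext_iff.1 (hxy δ (Finset.mem_union_right _ hδ))).2) hx)

theorem Cl_meas {Γ : Type} {C : Set (Γ → unitInterval)} (hC : C ∈ Cl Γ) : MeasurableSet C := by
  classical
  obtain ⟨A, _, q, D, hq, h⟩ := hC
  have e : C = ⋃ a ∈ {a : D → A | ∃ x ∈ C, ∀ d : D, q (x d) = a d},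
      ⋂ d : D, {x | x d ∈ q ⁻¹' {a d}} := by
    ext x
    simp only [Set.mem_iUnion, Set.mem_iInter, Set.mem_ofPred_eq, Set.mem_preimage,
      Set.mem_singleton_iff, exists_prop]
    constructor
    · intro hx
      exact ⟨fun d => q (x d), ⟨x, hx, fun d => rfl⟩, fun d => rfl⟩
    · rintro ⟨a, ⟨y, hy, hya⟩, hxa⟩
      exact h y x (fun δ hδ => (hya ⟨δ, hδ⟩).trans (hxa ⟨δ, hδ⟩).symm) hy
  rw [e]
  refine MeasurableSet.biUnion (Set.to_countable _) fun a _ => MeasurableSet.iInter fun d => ?_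
  exact measurable_pi_apply (d : Γ) (hq (a d))

theorem Cl_gen (Γ : Type) :
    (inferInstance : MeasurableSpace (Γ → unitInterval)) = MeasurableSpace.generateFrom (Cl Γ) := by
  classical
  apply le_antisymm
  · refine iSup_le fun i => ?_
    rintro _ ⟨s, hs, rfl⟩
    refine MeasurableSpace.measurableSet_generateFrom
      ⟨Bool, inferInstance, fun u => decide (u ∈ s), {i}, ?_, ?_⟩
    · intro b
      cases b
      · have : (fun u => decide (u ∈ s)) ⁻¹' {false} = sᶜ := by ext u; simp
        rw [this]; exact hs.compl
      · have : (fun u => decide (u ∈ s)) ⁻¹' {true} = s := by ext u; simp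
        rw [this]; exact hs
    · intro x y hxy hx
      have := hxy i (Finset.mem_singleton_self i)
      simp only [decide_eq_decide] at this
      exact this.1 hx
  · exact MeasurableSpace.generateFrom_le fun C hC => Cl_meas hC

theorem Cl_shift {n : ℕ} (γ : FreeGroup (Fin n)) {C : Set (FreeGroup (Fin n) → unitInterval)}
    (hC : C ∈ Cl (FreeGroup (Fin n))) : shiftMap γ ⁻¹' C ∈ Cl (FreeGroup (Fin n)) := by
  classical
  obtain ⟨A, _, q, D, hq, h⟩ := hC
  refine ⟨A, inferInstance, q, D.image (· * γ), hq, fun x y hxy hx => ?_⟩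
  exact h _ _ (fun δ hδ => hxy (δ * γ) (Finset.mem_image_of_mem _ hδ)) hx

theorem extract {n : ℕ} {lam : Measure (FreeGroup (Fin n) → unitInterval)}
    (hlam : IsLebesgueProductMeasure lam) {C : Set (FreeGroup (Fin n) → unitInterval)}
    (hC : C ∈ Cl (FreeGroup (Fin n)))
    (hind : ∀ i : Fin n, ∀ x, ¬ (x ∈ C ∧ shiftMap (FreeGroup.of i) x ∈ C)) {B : ℝ}
    (hB : ∀ (D : Finset (FreeGroup (Fin n))) (A : Type) [Fintype A]
      [DecidableEq A] (μ : A → ℝ) (_ : ∀ a, 0 ≤ μ a) (_ : ∑ a, μ a = 1) (f : (D → A) → Bool)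
      (_ : ∀ (i : Fin n) (a : FreeGroup (Fin n) → A),
        ¬ (f (fun d => a d) = true ∧ f (fun d => a (d * FreeGroup.of i)) = true)),
      ∑ y, pw μ y * (if f y = true then 1 else 0) ≤ B) :
    (lam C).toReal ≤ B := by
  classical
  obtain ⟨A, _, q, D, hq, h⟩ := hC
  let μ : A → ℝ := fun a => (volume (q ⁻¹' {a})).toReal
  let f : (D → A) → Bool := fun a => decide (∃ x ∈ C, ∀ d : D, q (x d) = a d)
  have hμ : ∑ a, μ a = 1 := by
    simp only [μ]
    rw [← ENNReal.toReal_sum (fun a _ => measure_ne_top _ _),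
      sum_measure_preimage_singleton _ (fun a _ => hq a)]
    simp
  refine le_trans ?_ (hB D A μ (fun a => ENNReal.toReal_nonneg) hμ f ?_)
  · have hcyl : ∀ y : D → A, lam {x | ∀ d : D, q (x d) = y d} = ∏ d, volume (q ⁻¹' {y d}) := by
      intro y
      have h1 := hlam D (fun δ => if hδ : δ ∈ D then q ⁻¹' {y ⟨δ, hδ⟩} else Set.univ) (by
        intro δ hδ
        simp only [hδ, dif_pos]
        exact hq _)
      rw [← Finset.prod_coe_sort] at h1
      simp only [Finset.coe_mem, dif_pos, Subtype.coe_eta] at h1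
      rw [← h1]
      congr 1
      ext x
      simp only [Set.mem_ofPred_eq]
      constructor
      · intro hx δ hδ
        simp only [hδ, dif_pos]
        exact hx ⟨δ, hδ⟩
      · rintro hx ⟨δ, hδ⟩
        have := hx δ hδ
        simp only [hδ, dif_pos] at this
        exact this
    have hsub : C ⊆ ⋃ y ∈ Finset.univ.filter (fun y => f y = true),
        {x | ∀ d : D, q (x d) = y d} := by
      intro x hx
      simp only [Set.mem_iUnion, Finset.mem_filter, Finset.mem_univ, true_and, exists_prop]
      exact ⟨fun d => q (x d), by simp only [f, decide_eq_true_eq]; exact ⟨x, hx, fun d => rfl⟩,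
        fun d => rfl⟩
    have hle := (measure_mono hsub).trans (measure_biUnion_finset_le (μ := lam) _ _)
    simp_rw [hcyl] at hle
    have hfin : ∀ y : D → A, ∏ d, volume (q ⁻¹' {y d}) ≠ ⊤ := fun y =>
      ENNReal.prod_ne_top fun d _ => measure_ne_top _ _
    have := ENNReal.toReal_mono (ENNReal.sum_ne_top.2 fun y _ => hfin y) hle
    rw [ENNReal.toReal_sum (fun y _ => hfin y), Finset.sum_filter] at this
    refine this.trans (le_of_eq (Finset.sum_congr rfl fun y _ => ?_))
    split_ifs
    · simp [pw, μ, ENNReal.toReal_prod]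
    · simp
  · rintro i a ⟨h1, h2⟩
    simp only [f, decide_eq_true_eq] at h1 h2
    obtain ⟨x, hx, hxa⟩ := h1
    obtain ⟨y, hy, hya⟩ := h2
    let z : FreeGroup (Fin n) → unitInterval := fun v =>
      if v ∈ D then x v else y (v * (FreeGroup.of i)⁻¹)
    refine hind i z ⟨h x z ?_ hx, h y _ ?_ hy⟩
    · intro δ hδ
      simp [z, hδ]
    · intro δ hδ
      rw [hya ⟨δ, hδ⟩]
      simp only [shiftMap, z]
      split_ifs with h3
      · exact (hxa ⟨_, h3⟩).symm
      · rw [mul_inv_cancel_right]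
        exact (hya ⟨δ, hδ⟩).symm

theorem indep_bound {n : ℕ} {lam : Measure (FreeGroup (Fin n) → unitInterval)}
    [IsProbabilityMeasure lam]
    (hlam : IsLebesgueProductMeasure lam) {I : Set (FreeGroup (Fin n) → unitInterval)}
    (hI : NullMeasurableSet I lam) (hindI : ∀ x ∈ I, ∀ y ∈ I, ¬ shiftSchreierAdj n x y) {B : ℝ}
    (hB : ∀ (D : Finset (FreeGroup (Fin n))) (A : Type) [Fintype A]
      [DecidableEq A] (μ : A → ℝ) (_ : ∀ a, 0 ≤ μ a) (_ : ∑ a, μ a = 1) (f : (D → A) → Bool)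
      (_ : ∀ (i : Fin n) (a : FreeGroup (Fin n) → A),
        ¬ (f (fun d => a d) = true ∧ f (fun d => a (d * FreeGroup.of i)) = true)),
      ∑ y, pw μ y * (if f y = true then 1 else 0) ≤ B) :
    (lam I).toReal ≤ B := by
  have hall : ∀ ε : ℝ, 0 < ε → lam.real I ≤ B + (2 * n + 1) * ε := by
    intro ε hε
    have hdense := Measure.MeasureDense.of_generateFrom_isSetAlgebra_finite lam
      (Cl_alg (FreeGroup (Fin n))) (Cl_gen _)
    obtain ⟨J, hJ, hIJ⟩ := hI
    obtain ⟨C, hC, hCJ⟩ := hdense.approx J hJ (measure_ne_top _ _) ε hε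
    have hCm : MeasurableSet C := Cl_meas hC
    have hInull : NullMeasurableSet I lam := ⟨J, hJ, hIJ⟩
    have hs : lam (symmDiff I C) < ENNReal.ofReal ε := by
      have e := measure_congr (ae_eq_set_symmDiff hIJ (Filter.EventuallyEq.refl (ae lam) C))
      exact e.le.trans_lt hCJ
    have hsr : ∀ S, S ⊆ symmDiff I C → lam.real S ≤ ε := fun S hS =>
      ENNReal.toReal_le_of_le_ofReal hε.le ((measure_mono hS).trans hs.le)
    have hCI : lam.real (C \ I) ≤ ε := hsr _ fun x hx => Or.inr hx
    have hIC : lam.real (I \ C) ≤ ε := hsr _ fun x hx => Or.inl hx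
    have hpre : ∀ i : Fin n, lam.real (C ∩ shiftMap (FreeGroup.of i) ⁻¹' C) ≤ 2 * ε := by
      intro i
      have hsub : C ∩ shiftMap (FreeGroup.of i) ⁻¹' C ⊆
          {x | x = shiftMap (FreeGroup.of i) x} ∪
            ((C \ I) ∪ shiftMap (FreeGroup.of i) ⁻¹' (C \ I)) := by
        rintro x ⟨hx, hx'⟩
        by_cases h1 : x ∈ I
        · by_cases h2 : shiftMap (FreeGroup.of i) x ∈ I
          · left
            by_contra h3
            exact hindI x h1 _ h2 ⟨h3, i, Or.inl rfl⟩
          · exact Or.inr (Or.inr ⟨hx', h2⟩)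
        · exact Or.inr (Or.inl ⟨hx, h1⟩)
      have hp : lam.real (shiftMap (FreeGroup.of i) ⁻¹' (C \ I)) ≤ ε := by
        have := (shift_mp hlam (FreeGroup.of i)).measure_preimage
          (hCm.nullMeasurableSet.diff hInull)
        rw [measureReal_def, this]
        exact hCI
      have h0 : lam.real {x | x = shiftMap (FreeGroup.of i) x} = 0 := by
        rw [measureReal_def, fix_null hlam i]; rfl
      calc _ ≤ _ := measureReal_mono hsub
        _ ≤ _ + _ := measureReal_union_le _ _
        _ ≤ _ + (_ + _) := by gcongr; exact measureReal_union_le _ _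
        _ ≤ 2 * ε := by linarith
    let C' := C \ ⋃ i ∈ (Finset.univ : Finset (Fin n)), shiftMap (FreeGroup.of i) ⁻¹' C
    have hC' : C' ∈ Cl _ := (Cl_alg _).sdiff_mem hC
      ((Cl_alg _).biUnion_mem _ fun i _ => Cl_shift _ hC)
    have h1 := extract hlam hC' (by
      rintro i x ⟨hx, hx'⟩
      refine hx.2 ?_
      simp only [Set.mem_iUnion]
      exact ⟨i, Finset.mem_univ i, hx'.1⟩) hB
    have hsub : I ⊆ C' ∪ ((I \ C) ∪ ⋃ i ∈ (Finset.univ : Finset (Fin n)),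
        (C ∩ shiftMap (FreeGroup.of i) ⁻¹' C)) := by
      intro x hx
      by_cases hxC : x ∈ C
      · by_cases hU : x ∈ ⋃ i ∈ (Finset.univ : Finset (Fin n)), shiftMap (FreeGroup.of i) ⁻¹' C
        · right; right
          simp only [Set.mem_iUnion] at hU ⊢
          obtain ⟨i, hi, hU⟩ := hU
          exact ⟨i, hi, hxC, hU⟩
        · exact Or.inl ⟨hxC, hU⟩
      · exact Or.inr (Or.inl ⟨hx, hxC⟩)
    have hU : lam.real (⋃ i ∈ (Finset.univ : Finset (Fin n)),
        (C ∩ shiftMap (FreeGroup.of i) ⁻¹' C)) ≤ n * (2 * ε) := by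
      refine (measureReal_biUnion_finset_le _ _).trans ?_
      refine (Finset.sum_le_sum fun i _ => hpre i).trans ?_
      simp
    calc lam.real I ≤ _ := measureReal_mono hsub
      _ ≤ _ + _ := measureReal_union_le _ _
      _ ≤ _ + (_ + _) := by gcongr; exact measureReal_union_le _ _
      _ ≤ B + (ε + n * (2 * ε)) := by gcongr; exact h1
      _ = _ := by ring
  refine le_of_forall_pos_le_add fun δ hδ => ?_
  have := hall (δ / (2 * n + 1)) (by positivity)
  rwa [mul_div_cancel₀ _ (by positivity)] at this

/-- Rahman–Virág. The maximal measure `s_n` of a `λ`-measurable,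
root-preserving-automorphism-invariant independent set in `H_n` satisfies
`limsup_n s_n · n / log n ≤ 1/2`, i.e. `s_n ≤ (1 + o(1)) log(2n)/(2n)`. -/
theorem rahman_virag_invariant_independence_bound
    (lam : ∀ n : ℕ, Measure (FreeGroup (Fin n) → unitInterval))
    (hprob : ∀ n, IsProbabilityMeasure (lam n))
    (hlam : ∀ n, IsLebesgueProductMeasure (lam n)) :
    Filter.limsup (fun n : ℕ =>
        sSup { r : ℝ | ∃ I : Set (FreeGroup (Fin n) → unitInterval),
            NullMeasurableSet I (lam n) ∧
            (∀ x ∈ I, ∀ y ∈ I, ¬ shiftSchreierAdj n x y) ∧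
            (∀ a : Equiv.Perm (FreeGroup (Fin n)),
              (∀ γ δ, cayleyAdj n γ δ ↔ cayleyAdj n (a γ) (a δ)) →
              a 1 = 1 →
              ∀ x ∈ I, (fun δ => x (a δ)) ∈ I) ∧
            r = ((lam n) I).toReal }
          * n / Real.log n)
      Filter.atTop ≤ 1 / 2 := by
  refine le_of_forall_pos_le_add fun κ₀ hκ₀ => ?_
  set κ := min κ₀ 1 with hκ
  have hκ0 : 0 < κ := lt_min hκ₀ one_pos
  have hev := rule_bound hκ0 (min_le_right _ _)
  have hnonneg : ∀ n : ℕ, 0 ≤ sSup { r : ℝ | ∃ I : Set (FreeGroup (Fin n) → unitInterval),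
            NullMeasurableSet I (lam n) ∧
            (∀ x ∈ I, ∀ y ∈ I, ¬ shiftSchreierAdj n x y) ∧
            (∀ a : Equiv.Perm (FreeGroup (Fin n)),
              (∀ γ δ, cayleyAdj n γ δ ↔ cayleyAdj n (a γ) (a δ)) →
              a 1 = 1 →
              ∀ x ∈ I, (fun δ => x (a δ)) ∈ I) ∧
            r = ((lam n) I).toReal } := by
    intro n
    refine Real.sSup_nonneg ?_
    rintro r ⟨I, -, -, -, rfl⟩
    exact ENNReal.toReal_nonneg
  refine le_trans (Filter.limsup_le_of_le (a := 1 / 2 + κ) ?_ ?_) ?_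
  · refine Filter.isCoboundedUnder_le_of_le Filter.atTop (x := 0) fun n => ?_
    exact div_nonneg (mul_nonneg (hnonneg n) (Nat.cast_nonneg n)) (Real.log_natCast_nonneg n)
  · filter_upwards [hev, Filter.eventually_ge_atTop 2] with n hB hn
    have hn0 : (0:ℝ) < n := by exact_mod_cast (by omega : 0 < n)
    have hl : 0 < Real.log n := Real.log_pos (by exact_mod_cast (by omega : 1 < n))
    rw [div_le_iff₀ hl, ← le_div_iff₀ hn0]
    refine Real.sSup_le ?_ (by positivity)
    rintro r ⟨I, hI, hind, -, rfl⟩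
    haveI := hprob n
    exact indep_bound (hlam n) hI hind hB
  · have : κ ≤ κ₀ := min_le_left _ _
    linarith
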